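/- Assume β ∈ (ϖ2, 0) in Case [N2] (in particular θ < −2 and f_ρ(β) > 0). Then for each b > 0 there exists a unique positive solution u_b of equation (E) in ℝ^N∖{0} satisfying u_b(x)/(b Φ_{ϖ2}(|x|)) → 1 as |x| → 0 and u_b(x)/U_{ρ,β}(x) → 1 as |x| → ∞. Moreover u_b is radially symmetric with radial derivative positive on (0,∞). -/

import Mathlib

open MeasureTheory Filter Topology Real RealInnerProductSpace

noncomputable section

/-- The gradient factor `G_τ(x,z,ξ) = z^τ ‖ξ‖^(1-τ) / ‖x‖^(τ+1)`.
For `τ = 0` this equals `‖ξ‖ / ‖x‖`, since `z ^ (0:ℝ) = 1` for real powers. -/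
def Gt {N : ℕ} (τ : ℝ) (x : EuclideanSpace ℝ (Fin N)) (z : ℝ)
    (ξ : EuclideanSpace ℝ (Fin N)) : ℝ :=
  z ^ τ * ‖ξ‖ ^ (1 - τ) / ‖x‖ ^ (τ + 1)

/-- Test functions: `C¹` functions with compact support contained in `Ω \ {0}`. -/
def IsTestFun {N : ℕ} (Ω : Set (EuclideanSpace ℝ (Fin N)))
    (φ : EuclideanSpace ℝ (Fin N) → ℝ) : Prop :=
  ContDiff ℝ 1 φ ∧ HasCompactSupport φ ∧ tsupport φ ⊆ Ω \ {0}

/-- The distributional pairing of equation (E) with a test function `φ`: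
`∫ ∇u·∇φ + (N-2+2ρ) ∫ ((x·∇u)/|x|²) φ - λ ∫ G_τ(x,u,∇u) φ + ∫ |x|^θ u^q φ`. -/
def weakE (N : ℕ) (ρ lam τ θ q : ℝ) (Ω : Set (EuclideanSpace ℝ (Fin N)))
    (u φ : EuclideanSpace ℝ (Fin N) → ℝ) : ℝ :=
  (∫ x in Ω \ {0}, ⟪gradient u x, gradient φ x⟫)
    + ((N : ℝ) - 2 + 2 * ρ) * (∫ x in Ω \ {0}, ⟪x, gradient u x⟫ / ‖x‖ ^ 2 * φ x)
    - lam * (∫ x in Ω \ {0}, Gt τ x (u x) (gradient u x) * φ x)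
    + ∫ x in Ω \ {0}, ‖x‖ ^ θ * u x ^ q * φ x

/-- A positive `C¹` function on `Ω \ {0}`. -/
def PosC1 {N : ℕ} (Ω : Set (EuclideanSpace ℝ (Fin N)))
    (u : EuclideanSpace ℝ (Fin N) → ℝ) : Prop :=
  ContDiffOn ℝ 1 u (Ω \ {0}) ∧ ∀ x ∈ Ω \ {0}, 0 < u x

/-- Positive distributional solution of equation (E) in `Ω \ {0}`. -/
def IsSolutionE (N : ℕ) (ρ lam τ θ q : ℝ) (Ω : Set (EuclideanSpace ℝ (Fin N)))
    (u : EuclideanSpace ℝ (Fin N) → ℝ) : Prop :=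
  PosC1 Ω u ∧ ∀ φ, IsTestFun Ω φ → weakE N ρ lam τ θ q Ω u φ = 0

/-- Positive sub-solution of equation (E) in `Ω \ {0}`. -/
def IsSubSolutionE (N : ℕ) (ρ lam τ θ q : ℝ) (Ω : Set (EuclideanSpace ℝ (Fin N)))
    (u : EuclideanSpace ℝ (Fin N) → ℝ) : Prop :=
  PosC1 Ω u ∧ ∀ φ, IsTestFun Ω φ → (∀ x, 0 ≤ φ x) → weakE N ρ lam τ θ q Ω u φ ≤ 0

/-- Positive super-solution of equation (E) in `Ω \ {0}`. -/
def IsSuperSolutionE (N : ℕ) (ρ lam τ θ q : ℝ) (Ω : Set (EuclideanSpace ℝ (Fin N)))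
    (u : EuclideanSpace ℝ (Fin N) → ℝ) : Prop :=
  PosC1 Ω u ∧ ∀ φ, IsTestFun Ω φ → (∀ x, 0 ≤ φ x) → 0 ≤ weakE N ρ lam τ θ q Ω u φ

/-- `f_ρ(t) = t (t + 2ρ) + λ |t|^(1-τ)`. -/
def fRho (ρ lam τ t : ℝ) : ℝ := t * (t + 2 * ρ) + lam * |t| ^ (1 - τ)

/-- `Υ = ((τ+1)/(2τ)) (λτ)^(1/(τ+1))`. -/
def Upsilon (lam τ : ℝ) : ℝ := ((τ + 1) / (2 * τ)) * (lam * τ) ^ (1 / (τ + 1))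

/-- Case [N₀]: (a) `τ = 0` and `λ ≥ 2ρ`, or (b) `λ > 0`, `τ ∈ (0,1)` and `ρ < Υ`. -/
def CaseN0 (ρ lam τ : ℝ) : Prop :=
  (τ = 0 ∧ 2 * ρ ≤ lam) ∨ (0 < lam ∧ 0 < τ ∧ τ < 1 ∧ ρ < Upsilon lam τ)

/-- Case [N₁]: (a) `τ = 0` and `λ < 2ρ`, or (b) `λ < 0` and `τ ∈ (0,1)`. -/
def CaseN1 (ρ lam τ : ℝ) : Prop :=
  (τ = 0 ∧ lam < 2 * ρ) ∨ (lam < 0 ∧ 0 < τ ∧ τ < 1)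

/-- Case [N₂]: `λ > 0`, `τ ∈ (0,1)` and `ρ ≥ Υ`. -/
def CaseN2 (ρ lam τ : ℝ) : Prop :=
  0 < lam ∧ 0 < τ ∧ τ < 1 ∧ Upsilon lam τ ≤ ρ

/-- `w` is the smallest negative root of `f_ρ` (i.e. `w = ϖ₁`). -/
def IsMinNegRoot (ρ lam τ w : ℝ) : Prop :=
  w < 0 ∧ fRho ρ lam τ w = 0 ∧ ∀ t, t < 0 → fRho ρ lam τ t = 0 → w ≤ t

/-- `w` is the largest negative root of `f_ρ` (i.e. `w = ϖ₂`). -/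
def IsMaxNegRoot (ρ lam τ w : ℝ) : Prop :=
  w < 0 ∧ fRho ρ lam τ w = 0 ∧ ∀ t, t < 0 → fRho ρ lam τ t = 0 → t ≤ w

/-- `Φ_{ϖ₂}(r)`: equal to `r^(-ϖ₂)` if `ρ > Υ` and to `r^(-ϖ₂) |log r|^(2/(1+τ))` if `ρ = Υ`. -/
def Phi2 (ρ lam τ w2 r : ℝ) : ℝ :=
  if ρ = Upsilon lam τ then r ^ (-w2) * |Real.log r| ^ (2 / (1 + τ)) else r ^ (-w2)

/-- `Ψ_{ϖ₁}(t)`: equal to `t^(-ϖ₁)` if `ρ > Υ` and to `t^(-ϖ₁) (log t)^(2/(1+τ))` if `ρ = Υ`. -/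
def Psi1 (ρ lam τ w1 t : ℝ) : ℝ :=
  if ρ = Upsilon lam τ then t ^ (-w1) * (Real.log t) ^ (2 / (1 + τ)) else t ^ (-w1)

/-- The radial operator `L_{ρ,λ,τ}[P](r) = P'' + (1-2ρ) P'/r + λ P^τ |P'|^(1-τ)/r^(1+τ)`. -/
def Lrad (ρ lam τ : ℝ) (P : ℝ → ℝ) (r : ℝ) : ℝ :=
  deriv (deriv P) r + (1 - 2 * ρ) * deriv P r / r
    + lam * P r ^ τ * |deriv P r| ^ (1 - τ) / r ^ (1 + τ)

/-- The Laplacian of `u` at `x`, as the trace of the second derivative. -/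
def lapl {N : ℕ} (u : EuclideanSpace ℝ (Fin N) → ℝ) (x : EuclideanSpace ℝ (Fin N)) : ℝ :=
  ∑ i : Fin N, iteratedFDeriv ℝ 2 u x ![EuclideanSpace.single i 1, EuclideanSpace.single i 1]

section WeakCalculus

variable {N : ℕ}

local notation "𝔼" => EuclideanSpace ℝ (Fin N)

lemma integrable_mul_of_tsupport_subset {g φ : 𝔼 → ℝ} {U : Set 𝔼} (hU : IsOpen U)
    (hg : ContinuousOn g U) (hφ : Continuous φ) (hc : HasCompactSupport φ)
    (hs : tsupport φ ⊆ U) : Integrable (fun x => g x * φ x) := by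
  have hcont : Continuous (fun x => g x * φ x) := by
    refine ContinuousOn.continuous_of_tsupport_subset (hg.mul hφ.continuousOn) hU ?_
    exact (tsupport_mul_subset_right (f := g) (g := φ)).trans hs
  exact hcont.integrable_of_hasCompactSupport hc.mul_left

lemma integral_mul_fderiv_of_tsupport_subset {g φ : 𝔼 → ℝ} {U : Set 𝔼} (hU : IsOpen U)
    (hg : ContDiffOn ℝ 1 g U) (hφ : ContDiff ℝ 1 φ) (hc : HasCompactSupport φ)
    (hs : tsupport φ ⊆ U) (v : 𝔼) :
    ∫ x, g x * fderiv ℝ φ x v = - ∫ x, fderiv ℝ g x v * φ x := by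
  have hφ' : Continuous fun x => fderiv ℝ φ x v :=
    (hφ.continuous_fderiv one_ne_zero).clm_apply continuous_const
  have hs' : tsupport (fun x => fderiv ℝ φ x v) ⊆ tsupport φ := by
    refine closure_minimal (fun x hx => ?_) (isClosed_tsupport φ)
    refine support_fderiv_subset ℝ ?_
    intro h
    exact hx (by simp [h])
  have hc' : HasCompactSupport fun x => fderiv ℝ φ x v := hc.fderiv_apply (𝕜 := ℝ) v
  have hg' : ContinuousOn (fun x => fderiv ℝ g x v) U :=
    (hg.continuousOn_fderiv_of_isOpen hU le_rfl).clm_apply continuousOn_const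
  exact integral_mul_fderiv_eq_neg_fderiv_mul_of_integrable
    (integrable_mul_of_tsupport_subset hU hg' hφ.continuous hc hs)
    (integrable_mul_of_tsupport_subset hU hg.continuousOn hφ' hc' (hs'.trans hs))
    (integrable_mul_of_tsupport_subset hU hg.continuousOn hφ.continuous hc hs)
    (fun x hx => (hg.differentiableOn one_ne_zero).differentiableAt (hU.mem_nhds (hs hx)))
    (fun x _ => hφ.differentiable one_ne_zero x)

lemma inner_gradient_eq_sum (y : 𝔼) (φ : 𝔼 → ℝ) (x : 𝔼) :
    ⟪y, gradient φ x⟫ = ∑ i, y i * fderiv ℝ φ x (EuclideanSpace.single i 1) := by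
  rw [real_inner_comm, gradient, InnerProductSpace.toDual_symm_apply]
  conv_lhs => rw [← (EuclideanSpace.basisFun (Fin N) ℝ).sum_repr y]
  simp [map_sum]

/-- The divergence theorem against a test function, for a field given by its components. -/
lemma integral_inner_gradient_eq_neg {X : 𝔼 → 𝔼} {φ : 𝔼 → ℝ} {U : Set 𝔼} (hU : IsOpen U)
    (hX : ContDiffOn ℝ 1 X U) (hφ : ContDiff ℝ 1 φ) (hc : HasCompactSupport φ)
    (hs : tsupport φ ⊆ U) :
    ∫ x, ⟪X x, gradient φ x⟫ =
      - ∫ x, (∑ i, fderiv ℝ (fun y => X y i) x (EuclideanSpace.single i 1)) * φ x := by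
  have hXi : ∀ i, ContDiffOn ℝ 1 (fun y => X y i) U := fun i => by
    exact (EuclideanSpace.proj (𝕜 := ℝ) i : 𝔼 →L[ℝ] ℝ).contDiff.comp_contDiffOn hX
  simp_rw [inner_gradient_eq_sum, Finset.sum_mul]
  have hφ' : ∀ v, Continuous fun x => fderiv ℝ φ x v := fun v =>
    (hφ.continuous_fderiv one_ne_zero).clm_apply continuous_const
  have hs' : ∀ v, tsupport (fun x => fderiv ℝ φ x v) ⊆ U := fun v => by
    refine (closure_minimal (fun x hx => ?_) (isClosed_tsupport φ)).trans hs
    refine support_fderiv_subset ℝ ?_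
    intro h
    exact hx (by simp [h])
  rw [integral_finsetSum, integral_finsetSum, ← Finset.sum_neg_distrib]
  · exact Finset.sum_congr rfl fun i _ =>
      integral_mul_fderiv_of_tsupport_subset hU (hXi i) hφ hc hs _
  · intro i _
    refine integrable_mul_of_tsupport_subset hU ?_ hφ.continuous hc hs
    exact ((hXi i).continuousOn_fderiv_of_isOpen hU le_rfl).clm_apply continuousOn_const
  · intro i _
    exact integrable_mul_of_tsupport_subset hU (hXi i).continuousOn (hφ' _)
      (hc.fderiv_apply (𝕜 := ℝ) _) (hs' _)

end WeakCalculus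

section Comparison

variable {N : ℕ}

local notation "𝔼" => EuclideanSpace ℝ (Fin N)

lemma inner_gradient_eq_fderiv (y : 𝔼) (φ : 𝔼 → ℝ) (x : 𝔼) :
    ⟪y, gradient φ x⟫ = fderiv ℝ φ x y := by
  rw [real_inner_comm, gradient, InnerProductSpace.toDual_symm_apply]

lemma continuousOn_gradient {u : 𝔼 → ℝ} {U : Set 𝔼} (hU : IsOpen U)
    (hu : ContDiffOn ℝ 1 u U) : ContinuousOn (gradient u) U :=
  (InnerProductSpace.toDual ℝ 𝔼).symm.continuous.comp_continuousOn
    (hu.continuousOn_fderiv_of_isOpen hU le_rfl)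

lemma integrable_inner_gradient {X : 𝔼 → 𝔼} {φ : 𝔼 → ℝ} {U : Set 𝔼} (hU : IsOpen U)
    (hX : ContinuousOn X U) (hφ : ContDiff ℝ 1 φ) (hc : HasCompactSupport φ)
    (hs : tsupport φ ⊆ U) : Integrable (fun x => ⟪X x, gradient φ x⟫) := by
  have hs' : tsupport (fun x => ⟪X x, gradient φ x⟫) ⊆ tsupport φ := by
    refine closure_minimal (fun x hx => ?_) (isClosed_tsupport φ)
    refine support_fderiv_subset ℝ ?_
    intro h
    exact hx (by simp [h])
  have hcont : Continuous (fun x => ⟪X x, gradient φ x⟫) := by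
    refine ContinuousOn.continuous_of_tsupport_subset ?_ hU (hs'.trans hs)
    exact hX.inner ((continuousOn_gradient isOpen_univ hφ.contDiffOn).mono (Set.subset_univ _))
  exact hcont.integrable_of_hasCompactSupport (hc.of_isClosed_subset (isClosed_tsupport _) hs')

/-- A nonnegative `C¹` function which is strictly superharmonic in the weak sense on a ball
cannot vanish at the centre. -/
lemma weak_strict_superharmonic_ne_zero [NeZero N] {d : 𝔼 → ℝ} {x₀ : 𝔼} {r δ : ℝ} (hr : 0 < r)
    (hδ : 0 < δ) (hd : ContDiffOn ℝ 1 d (Metric.ball x₀ r))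
    (hd0 : ∀ x ∈ Metric.ball x₀ r, 0 ≤ d x)
    (h : ∀ φ : 𝔼 → ℝ, ContDiff ℝ 1 φ → HasCompactSupport φ → tsupport φ ⊆ Metric.ball x₀ r →
      (∀ x, 0 ≤ φ x) → δ * ∫ x, φ x ≤ ∫ x, ⟪gradient d x, gradient φ x⟫) :
    d x₀ ≠ 0 := by
  intro hx₀
  have hN : (0 : ℝ) < N := by exact_mod_cast Nat.pos_of_ne_zero (NeZero.ne N)
  set a : ℝ := δ / (4 * N) with ha
  have ha0 : 0 < a := by positivity
  set m : ℝ := a * (r / 2) ^ 2 with hm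
  have hm0 : 0 < m := by positivity
  set B := Metric.ball x₀ r with hB
  set e : 𝔼 → ℝ := fun x => d x + a * ‖x - x₀‖ ^ 2 with he
  have heC : ContDiffOn ℝ 1 e B := by
    refine hd.add (ContDiff.contDiffOn ?_)
    exact contDiff_const.mul ((contDiff_id.sub contDiff_const).norm_sq ℝ)
  classical
  set φ : 𝔼 → ℝ := fun x => if x ∈ B then expNegInvGlue (m - e x) else 0 with hφdef
  have hφin : ∀ x ∈ B, φ x = expNegInvGlue (m - e x) := fun x hx => by simp [hφdef, hx]
  have hφout : ∀ x, x ∉ Metric.closedBall x₀ (r / 2) → φ x = 0 := by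
    intro x hx
    by_cases hxB : x ∈ B
    · rw [hφin x hxB]
      apply expNegInvGlue.zero_of_nonpos
      have h1 : r / 2 < ‖x - x₀‖ := by simpa [dist_eq_norm] using hx
      have h2 := hd0 x hxB
      have h3 : (r / 2) ^ 2 ≤ ‖x - x₀‖ ^ 2 := by gcongr
      have h4 := mul_le_mul_of_nonneg_left h3 ha0.le
      simp only [he, hm]; linarith
    · simp [hφdef, hxB]
  have hcB : Metric.closedBall x₀ (r / 2) ⊆ B := Metric.closedBall_subset_ball (by linarith)
  have hts : tsupport φ ⊆ Metric.closedBall x₀ (r / 2) := by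
    refine closure_minimal (fun x hx => ?_) Metric.isClosed_closedBall
    by_contra hcon
    exact hx (hφout x hcon)
  have hφc : HasCompactSupport φ :=
    (isCompact_closedBall x₀ (r / 2)).of_isClosed_subset (isClosed_tsupport _) hts
  have hφ0 : ∀ x, 0 ≤ φ x := fun x => by
    simp only [hφdef]; split_ifs
    · exact expNegInvGlue.nonneg _
    · exact le_rfl
  have hφev : ∀ x ∈ B, φ =ᶠ[𝓝 x] fun y => expNegInvGlue (m - e y) := fun x hx => by
    filter_upwards [Metric.isOpen_ball.mem_nhds hx] with y hy using hφin y hy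
  have hφC : ContDiff ℝ 1 φ := by
    rw [contDiff_iff_contDiffAt]
    intro x
    by_cases hx : x ∈ B
    · refine ContDiffAt.congr_of_eventuallyEq ?_ (hφev x hx)
      exact (expNegInvGlue.contDiff (n := 1)).contDiffAt.comp x
        (contDiffAt_const.sub (heC.contDiffAt (Metric.isOpen_ball.mem_nhds hx)))
    · have : φ =ᶠ[𝓝 x] fun _ => 0 := by
        have : (Metric.closedBall x₀ (r / 2))ᶜ ∈ 𝓝 x :=
          Metric.isClosed_closedBall.isOpen_compl.mem_nhds fun hh => hx (hcB hh)
        filter_upwards [this] with y hy using hφout y hy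
      exact contDiffAt_const.congr_of_eventuallyEq this
  have hintegral : 0 < ∫ x, φ x := by
    refine hφC.continuous.integral_pos_of_hasCompactSupport_nonneg_nonzero hφc hφ0 (x := x₀) ?_
    rw [hφin x₀ (Metric.mem_ball_self hr)]
    refine (expNegInvGlue.pos_of_pos ?_).ne'
    simp [he, hx₀, hm0]
  have hX : ContDiff ℝ 1 (fun x : 𝔼 => (-(2 * a)) • (x - x₀)) :=
    (contDiff_id.sub contDiff_const).const_smul _
  have hIBP := integral_inner_gradient_eq_neg (X := fun x : 𝔼 => (-(2 * a)) • (x - x₀))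
    isOpen_univ hX.contDiffOn hφC hφc (Set.subset_univ _)
  have hdiv : ∀ x : 𝔼, (∑ i, fderiv ℝ (fun y : 𝔼 => ((-(2 * a)) • (y - x₀)) i) x
      (EuclideanSpace.single i 1)) = -(2 * a) * N := by
    intro x
    have : ∀ i : Fin N, fderiv ℝ (fun y : 𝔼 => ((-(2 * a)) • (y - x₀)) i) x
      (EuclideanSpace.single i 1) = -(2 * a) := by
      intro i
      have hlin : HasFDerivAt (fun y : 𝔼 => ((-(2 * a)) • (y - x₀)) i)
          ((-(2 * a)) • (EuclideanSpace.proj (𝕜 := ℝ) i : 𝔼 →L[ℝ] ℝ)) x := by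
        have := ((EuclideanSpace.proj (𝕜 := ℝ) i : 𝔼 →L[ℝ] ℝ).hasFDerivAt (x := x)).sub_const
          (x₀ i) |>.const_mul (-(2 * a))
        simpa using this
      rw [hlin.fderiv]; simp
    rw [Finset.sum_congr rfl fun i _ => this i]
    simp
    ring
  simp_rw [hdiv] at hIBP
  rw [integral_const_mul] at hIBP
  have hle : ∫ x, ⟪gradient d x, gradient φ x⟫
      ≤ ∫ x, ⟪(-(2 * a)) • (x - x₀), gradient φ x⟫ := by
    refine integral_mono
      (integrable_inner_gradient Metric.isOpen_ball (continuousOn_gradient Metric.isOpen_ball hd)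
        hφC hφc (hts.trans hcB))
      (integrable_inner_gradient isOpen_univ hX.continuous.continuousOn hφC hφc
        (Set.subset_univ _)) fun x => ?_
    simp only [inner_gradient_eq_fderiv]
    by_cases hx : x ∈ B
    · have hde : HasFDerivAt e (fderiv ℝ d x + a • (2 • (innerSL ℝ (x - x₀)))) x := by
        have h1 := ((hd.differentiableOn one_ne_zero).differentiableAt
          (Metric.isOpen_ball.mem_nhds hx)).hasFDerivAt
        have h2 := ((hasFDerivAt_id x).sub_const x₀).norm_sq.const_mul a
        refine (h1.add h2).congr_fderiv ?_
        ext y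
        simp
      have hη : HasDerivAt expNegInvGlue (deriv expNegInvGlue (m - e x)) (m - e x) :=
        ((expNegInvGlue.contDiff (n := 1)).differentiable one_ne_zero _).hasDerivAt
      have hη0 : 0 ≤ deriv expNegInvGlue (m - e x) := expNegInvGlue.monotone.deriv_nonneg
      have hφd := (hη.comp_hasFDerivAt x (hde.const_sub m)).congr_of_eventuallyEq (hφev x hx)
      have hφy : ∀ y, fderiv ℝ φ x y = -(deriv expNegInvGlue (m - e x) *
          (⟪gradient d x, y⟫ + 2 * a * ⟪x - x₀, y⟫)) := fun y => by
        rw [hφd.fderiv, real_inner_comm, inner_gradient_eq_fderiv]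
        simp only [smul_apply, neg_apply,
          add_apply, innerSL_apply_apply, smul_eq_mul, nsmul_eq_mul]
        push_cast
        ring
      have hsq : 0 ≤ ⟪gradient d x + (2 * a) • (x - x₀), gradient d x + (2 * a) • (x - x₀)⟫ :=
        real_inner_self_nonneg
      have key : fderiv ℝ φ x (gradient d x) - fderiv ℝ φ x ((-(2 * a)) • (x - x₀)) =
          -(deriv expNegInvGlue (m - e x) *
            ⟪gradient d x + (2 * a) • (x - x₀), gradient d x + (2 * a) • (x - x₀)⟫) := by
        rw [hφy, hφy]
        generalize gradient d x = g
        simp only [inner_add_left, inner_add_right, real_inner_smul_left, real_inner_smul_right]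
        ring
      have := mul_nonneg hη0 hsq
      linarith
    · have : fderiv ℝ φ x = 0 := by
        by_contra hcon
        exact hx (hcB (hts (support_fderiv_subset ℝ hcon)))
      simp [this]
  have h1 := h φ hφC hφc (hts.trans hcB) hφ0
  have h2 : 2 * a * N = δ / 2 := by rw [ha]; field_simp; ring
  nlinarith [hIBP, hle, h1, mul_pos hδ hintegral]

end Comparison

section Uniqueness

variable {N : ℕ}

local notation "𝔼" => EuclideanSpace ℝ (Fin N)

/-- The lower order part of equation (E): a solution satisfies `-Δu = lowerOrder u`. -/
def lowerOrder (N : ℕ) (ρ lam τ θ q : ℝ) (u : EuclideanSpace ℝ (Fin N) → ℝ)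
    (x : EuclideanSpace ℝ (Fin N)) : ℝ :=
  -(((N : ℝ) - 2 + 2 * ρ) * (⟪x, gradient u x⟫ / ‖x‖ ^ 2)) + lam * Gt τ x (u x) (gradient u x)
    - ‖x‖ ^ θ * u x ^ q

lemma PosC1.contDiffOn {u : 𝔼 → ℝ} (hu : PosC1 Set.univ u) : ContDiffOn ℝ 1 u {0}ᶜ := by
  simpa [Set.compl_eq_univ_sdiff] using hu.1

lemma PosC1.pos {u : 𝔼 → ℝ} (hu : PosC1 Set.univ u) {x : 𝔼} (hx : x ≠ 0) : 0 < u x :=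
  hu.2 x ⟨trivial, hx⟩

lemma continuousOn_Gt {τ : ℝ} (hτ1 : τ < 1) {u : 𝔼 → ℝ}
    (hu : PosC1 Set.univ u) : ContinuousOn (fun x => Gt τ x (u x) (gradient u x)) {0}ᶜ := by
  have hg : ContinuousOn (gradient u) {0}ᶜ :=
    continuousOn_gradient isOpen_compl_singleton hu.contDiffOn
  unfold Gt
  refine ContinuousOn.div (ContinuousOn.mul ?_ ?_) ?_ ?_
  · exact hu.contDiffOn.continuousOn.rpow_const fun x hx => Or.inl (hu.pos hx).ne'
  · exact hg.norm.rpow_const fun x _ => Or.inr (by linarith)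
  · exact continuousOn_id.norm.rpow_const fun x hx => Or.inl (norm_ne_zero_iff.2 hx)
  · intro x hx
    exact (Real.rpow_pos_of_pos (norm_pos_iff.2 hx) _).ne'

lemma continuousOn_drift {u : 𝔼 → ℝ} (hu : PosC1 Set.univ u) :
    ContinuousOn (fun x => ⟪x, gradient u x⟫ / ‖x‖ ^ 2) {0}ᶜ := by
  have hg : ContinuousOn (gradient u) {0}ᶜ :=
    continuousOn_gradient isOpen_compl_singleton hu.contDiffOn
  exact (continuousOn_id.inner hg).div (continuousOn_id.norm.pow 2) fun x hx =>
    pow_ne_zero _ (norm_ne_zero_iff.2 hx)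

lemma continuousOn_absorption (θ q : ℝ) {u : 𝔼 → ℝ} (hu : PosC1 Set.univ u) :
    ContinuousOn (fun x => ‖x‖ ^ θ * u x ^ q) {0}ᶜ := by
  refine ContinuousOn.mul ?_ ?_
  · exact continuousOn_id.norm.rpow_const fun x hx => Or.inl (norm_ne_zero_iff.2 hx)
  · exact hu.contDiffOn.continuousOn.rpow_const fun x hx => Or.inl (hu.pos hx).ne'

lemma continuousOn_lowerOrder (ρ lam θ q : ℝ) {τ : ℝ} (hτ1 : τ < 1) {u : 𝔼 → ℝ}
    (hu : PosC1 Set.univ u) : ContinuousOn (lowerOrder N ρ lam τ θ q u) {0}ᶜ :=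
  ((continuousOn_const.mul (continuousOn_drift hu)).neg.add
    (continuousOn_const.mul (continuousOn_Gt hτ1 hu))).sub (continuousOn_absorption θ q hu)

lemma weakE_eq [NeZero N] (ρ lam θ q : ℝ) {τ : ℝ} (hτ1 : τ < 1) {u φ : 𝔼 → ℝ}
    (hu : PosC1 Set.univ u) (hφ : IsTestFun Set.univ φ) :
    weakE N ρ lam τ θ q Set.univ u φ =
      (∫ x, ⟪gradient u x, gradient φ x⟫) - ∫ x, lowerOrder N ρ lam τ θ q u x * φ x := by
  obtain ⟨hφ1, hφc, hφs⟩ := hφ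
  rw [← Set.compl_eq_univ_sdiff] at hφs
  have hres : (volume : Measure 𝔼).restrict (Set.univ \ {0}) = volume := by
    rw [← Set.compl_eq_univ_sdiff]
    exact restrict_compl_singleton 0
  have hI : ∀ g : 𝔼 → ℝ, ContinuousOn g {0}ᶜ → Integrable (fun x => g x * φ x) := fun g hg =>
    integrable_mul_of_tsupport_subset isOpen_compl_singleton hg hφ1.continuous hφc hφs
  have h1 := hI _ (continuousOn_drift hu)
  have h2 := hI _ (continuousOn_Gt hτ1 hu)
  have h3 := hI _ (continuousOn_absorption θ q hu)
  unfold weakE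
  rw [hres]
  have : (fun x => lowerOrder N ρ lam τ θ q u x * φ x) = fun x =>
      (-(((N : ℝ) - 2 + 2 * ρ) * (⟪x, gradient u x⟫ / ‖x‖ ^ 2 * φ x))
        + lam * (Gt τ x (u x) (gradient u x) * φ x)) - ‖x‖ ^ θ * u x ^ q * φ x := by
    funext x; unfold lowerOrder; ring
  rw [this, integral_sub _ h3, integral_add _ (h2.const_mul _), integral_neg, integral_const_mul,
    integral_const_mul]
  · ring
  · exact (h1.const_mul _).neg
  · exact (h1.const_mul _).neg.add (h2.const_mul _)

lemma solution_le_of_tendsto [NeZero N] {ρ lam τ θ q : ℝ} (hτ1 : τ < 1) (hq : 1 < q)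
    {u w : 𝔼 → ℝ} (hu : IsSolutionE N ρ lam τ θ q Set.univ u)
    (hw : IsSolutionE N ρ lam τ θ q Set.univ w)
    (h0 : Tendsto (fun x => u x / w x) (𝓝[≠] 0) (𝓝 1))
    (hinf : Tendsto (fun x => u x / w x) (cocompact 𝔼) (𝓝 1)) {x : 𝔼} (hx : x ≠ 0) :
    u x ≤ w x := by
  by_contra! hcon
  obtain ⟨huP, huE⟩ := hu
  obtain ⟨hwP, hwE⟩ := hw
  set c₁ := u x / w x with hc₁
  have hc₁1 : 1 < c₁ := (one_lt_div (hwP.pos hx)).2 hcon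
  -- the supremum of the quotient is attained
  obtain ⟨x₀, hx₀, hmax, hge⟩ : ∃ x₀ : 𝔼, x₀ ≠ 0 ∧ (∀ y : 𝔼, y ≠ 0 → u y / w y ≤ u x₀ / w x₀) ∧
      c₁ ≤ u x₀ / w x₀ := by
    have hn0 := h0.eventually (gt_mem_nhds hc₁1)
    have hni := hinf.eventually (gt_mem_nhds hc₁1)
    obtain ⟨V, hV, hVs⟩ := mem_nhdsWithin_iff_exists_mem_nhds_inter.1 hn0
    obtain ⟨ε, hε, hεs⟩ := Metric.mem_nhds_iff.1 hV
    obtain ⟨K, hK, hKs⟩ := mem_cocompact.1 hni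
    have hS : IsCompact (K \ Metric.ball (0 : 𝔼) ε) := hK.diff Metric.isOpen_ball
    have hout : ∀ y : 𝔼, y ≠ 0 → y ∉ K \ Metric.ball (0 : 𝔼) ε → u y / w y < c₁ := by
      intro y hy hyn
      by_cases hyK : y ∈ K
      · have : y ∈ Metric.ball (0 : 𝔼) ε := by
          by_contra hb; exact hyn ⟨hyK, hb⟩
        exact hVs ⟨hεs this, hy⟩
      · exact hKs hyK
    have hxS : x ∈ K \ Metric.ball (0 : 𝔼) ε := by
      by_contra hb; exact lt_irrefl _ (hout x hx hb)
    have hS0 : K \ Metric.ball (0 : 𝔼) ε ⊆ {0}ᶜ := by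
      rintro y hy rfl
      exact hy.2 (Metric.mem_ball_self hε)
    have hcont : ContinuousOn (fun y => u y / w y) (K \ Metric.ball (0 : 𝔼) ε) :=
      (huP.contDiffOn.continuousOn.mono hS0).div (hwP.contDiffOn.continuousOn.mono hS0)
        fun y hy => (hwP.pos (hS0 hy)).ne'
    obtain ⟨x₀, hx₀S, hx₀⟩ := hS.exists_isMaxOn ⟨x, hxS⟩ hcont
    refine ⟨x₀, hS0 hx₀S, fun y hy => ?_, hx₀ hxS⟩
    by_cases hyS : y ∈ K \ Metric.ball (0 : 𝔼) ε
    · exact hx₀ hyS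
    · exact ((hout y hy hyS).le).trans (hx₀ hxS)
  set c := u x₀ / w x₀ with hc
  have hc1 : 1 < c := hc₁1.trans_le hge
  have hc0 : 0 < c := by linarith
  have hw0 := hwP.pos hx₀
  have hux₀ : u x₀ = c * w x₀ := by rw [hc]; field_simp
  set d : 𝔼 → ℝ := fun y => c * w y - u y with hd
  have hdC : ContDiffOn ℝ 1 d {0}ᶜ := (contDiffOn_const.mul hwP.contDiffOn).sub huP.contDiffOn
  have hdnn : ∀ y ≠ 0, 0 ≤ d y := fun y hy => by
    have := (div_le_iff₀ (hwP.pos hy)).1 (hmax y hy)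
    simp only [hd]; linarith
  have hdx₀ : d x₀ = 0 := by simp [hd, hux₀]
  have hnhds : ∀ y : 𝔼, y ≠ 0 → ({0}ᶜ : Set 𝔼) ∈ 𝓝 y := fun y hy =>
    isOpen_compl_singleton.mem_nhds hy
  have hgrad : ∀ y : 𝔼, y ≠ 0 → gradient d y = c • gradient w y - gradient u y := fun y hy => by
    have e1 := ((hwP.contDiffOn.contDiffAt (hnhds y hy)).differentiableAt one_ne_zero).const_mul c
    have e2 := (huP.contDiffOn.contDiffAt (hnhds y hy)).differentiableAt one_ne_zero
    have e3 := (hwP.contDiffOn.contDiffAt (hnhds y hy)).differentiableAt one_ne_zero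
    have : fderiv ℝ d y = c • fderiv ℝ w y - fderiv ℝ u y := by
      rw [hd, fderiv_fun_sub e1 e2, fderiv_const_mul e3]
    simp [gradient, this]
  have hgrad₀ : gradient u x₀ = c • gradient w x₀ := by
    have hmin : IsLocalMin d x₀ := by
      filter_upwards [hnhds x₀ hx₀] with y hy
      rw [hdx₀]; exact hdnn y hy
    have h1 : gradient d x₀ = 0 := by simp [gradient, hmin.fderiv_eq_zero]
    rw [hgrad x₀ hx₀] at h1
    exact (sub_eq_zero.1 h1).symm
  set H : 𝔼 → ℝ := fun y => c * lowerOrder N ρ lam τ θ q w y - lowerOrder N ρ lam τ θ q u y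
    with hH
  have hHC : ContinuousOn H {0}ᶜ :=
    (continuousOn_const.mul (continuousOn_lowerOrder ρ lam θ q hτ1 hwP)).sub
      (continuousOn_lowerOrder ρ lam θ q hτ1 huP)
  have hHx₀ : 0 < H x₀ := by
    have hG : Gt τ x₀ (u x₀) (gradient u x₀) = c * Gt τ x₀ (w x₀) (gradient w x₀) := by
      unfold Gt
      rw [hux₀, hgrad₀, norm_smul, Real.norm_of_nonneg hc0.le, Real.mul_rpow hc0.le hw0.le,
        Real.mul_rpow hc0.le (norm_nonneg _)]
      have : c ^ τ * c ^ (1 - τ) = c := by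
        rw [← Real.rpow_add hc0]; simp
      calc _ = (c ^ τ * c ^ (1 - τ)) * (w x₀ ^ τ * ‖gradient w x₀‖ ^ (1 - τ)) / ‖x₀‖ ^ (τ + 1) := by
            ring
        _ = _ := by rw [this]; ring
    have hval : H x₀ = ‖x₀‖ ^ θ * w x₀ ^ q * (c ^ q - c) := by
      simp only [hH, lowerOrder]
      rw [hG, hgrad₀, hux₀, real_inner_smul_right, Real.mul_rpow hc0.le hw0.le]
      ring
    rw [hval]
    have h1 : c < c ^ q := by
      simpa using Real.rpow_lt_rpow_of_exponent_lt hc1 hq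
    have h2 := Real.rpow_pos_of_pos (norm_pos_iff.2 hx₀) θ
    have h3 := Real.rpow_pos_of_pos hw0 q
    exact mul_pos (mul_pos h2 h3) (by linarith)
  have hev : ∀ᶠ y in 𝓝 x₀, H x₀ / 2 < H y :=
    ((hHC.continuousAt (hnhds x₀ hx₀)).eventually (lt_mem_nhds (by linarith)))
  obtain ⟨r, hr, hrs⟩ := Metric.mem_nhds_iff.1 (inter_mem hev (hnhds x₀ hx₀))
  have hrs0 : Metric.ball x₀ r ⊆ {0}ᶜ := fun y hy => (hrs hy).2
  refine weak_strict_superharmonic_ne_zero (d := d) (x₀ := x₀) (δ := H x₀ / 2) hr (by linarith)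
    (hdC.mono hrs0) (fun y hy => hdnn y (hrs0 hy)) ?_ hdx₀
  intro φ hφ hφc hφs hφ0
  have hφs0 := hφs.trans hrs0
  have hT : IsTestFun Set.univ φ := ⟨hφ, hφc, by rwa [← Set.compl_eq_univ_sdiff]⟩
  have hU := huE φ hT
  have hW := hwE φ hT
  rw [weakE_eq ρ lam θ q hτ1 huP hT] at hU
  rw [weakE_eq ρ lam θ q hτ1 hwP hT] at hW
  have hIu := integrable_inner_gradient isOpen_compl_singleton
    (continuousOn_gradient isOpen_compl_singleton huP.contDiffOn) hφ hφc hφs0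
  have hIw := integrable_inner_gradient isOpen_compl_singleton
    (continuousOn_gradient isOpen_compl_singleton hwP.contDiffOn) hφ hφc hφs0
  have hLu := integrable_mul_of_tsupport_subset isOpen_compl_singleton
    (continuousOn_lowerOrder ρ lam θ q hτ1 huP) hφ.continuous hφc hφs0
  have hLw := integrable_mul_of_tsupport_subset isOpen_compl_singleton
    (continuousOn_lowerOrder ρ lam θ q hτ1 hwP) hφ.continuous hφc hφs0
  have hE1 : ∫ y, ⟪gradient d y, gradient φ y⟫ =
      c * (∫ y, ⟪gradient w y, gradient φ y⟫) - ∫ y, ⟪gradient u y, gradient φ y⟫ := by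
    rw [← integral_const_mul, ← integral_sub (hIw.const_mul c) hIu]
    have hae : ∀ᵐ y : 𝔼, y ≠ 0 := Measure.ae_ne volume 0
    refine integral_congr_ae ?_
    filter_upwards [hae] with y hy
    rw [hgrad y hy, inner_sub_left, real_inner_smul_left]
  have hE2 : ∫ y, H y * φ y = c * (∫ y, lowerOrder N ρ lam τ θ q w y * φ y)
      - ∫ y, lowerOrder N ρ lam τ θ q u y * φ y := by
    rw [← integral_const_mul, ← integral_sub (hLw.const_mul c) hLu]
    refine integral_congr_ae (Eventually.of_forall fun y => ?_)
    simp only [hH]; ring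
  have hE3 : H x₀ / 2 * ∫ y, φ y ≤ ∫ y, H y * φ y := by
    rw [← integral_const_mul]
    refine integral_mono ((hφ.continuous.integrable_of_hasCompactSupport hφc).const_mul _)
      (integrable_mul_of_tsupport_subset isOpen_compl_singleton hHC hφ.continuous hφc hφs0)
      fun y => ?_
    by_cases hy : y ∈ tsupport φ
    · exact mul_le_mul_of_nonneg_right (hrs (hφs hy)).1.le (hφ0 y)
    · simp [image_eq_zero_of_notMem_tsupport hy]
  have hE4 : ∫ y, ⟪gradient d y, gradient φ y⟫ = ∫ y, H y * φ y := by
    rw [hE1, hE2, sub_eq_zero.1 hU, sub_eq_zero.1 hW]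
  rw [hE4]; exact hE3

end Uniqueness

section Radial

variable {N : ℕ}

local notation "𝔼" => EuclideanSpace ℝ (Fin N)

lemma hasFDerivAt_comp_norm {g : ℝ → ℝ} {g' : ℝ} {x : 𝔼} (hx : x ≠ 0)
    (hg : HasDerivAt g g' ‖x‖) :
    HasFDerivAt (fun y : 𝔼 => g ‖y‖) ((g' / ‖x‖) • innerSL ℝ x) x := by
  have hx' := norm_pos_iff.2 hx
  have hn : HasFDerivAt (fun y : 𝔼 => ‖y‖) ((1 / ‖x‖) • innerSL ℝ x) x := by
    have h1 := ((hasStrictFDerivAt_norm_sq x).hasFDerivAt.sqrt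
      (by positivity : ‖x‖ ^ 2 ≠ 0))
    simp only [Real.sqrt_sq (norm_nonneg _)] at h1
    refine h1.congr_fderiv ?_
    ext y
    simp
    field_simp
  refine (hg.comp_hasFDerivAt x hn).congr_fderiv ?_
  ext y
  simp
  ring

lemma contDiffAt_comp_norm {g : ℝ → ℝ} (hg : ContDiffOn ℝ 1 g (Set.Ioi 0)) :
    ContDiffOn ℝ 1 (fun y : 𝔼 => g ‖y‖) {0}ᶜ := by
  refine hg.comp (fun x hx => (contDiffAt_norm ℝ hx).contDiffWithinAt) fun x hx => ?_
  exact norm_pos_iff.2 hx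

lemma contDiffOn_one_of_hasDerivAt {g g' : ℝ → ℝ} {s : Set ℝ} (hs : IsOpen s)
    (hg : ∀ r ∈ s, HasDerivAt g (g' r) r) (hg' : ContinuousOn g' s) : ContDiffOn ℝ 1 g s := by
  rw [show (1 : WithTop ℕ∞) = 0 + 1 by simp, contDiffOn_succ_iff_deriv_of_isOpen hs]
  refine ⟨fun r hr => (hg r hr).differentiableAt.differentiableWithinAt, by simp, ?_⟩
  rw [contDiffOn_zero]
  exact hg'.congr fun r hr => (hg r hr).deriv

/-- A radial profile `v` with `v' = r p` solving the radial equation gives a solution of (E). -/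
lemma isSolutionE_of_radial [NeZero N] {ρ lam τ θ q : ℝ} (hτ1 : τ < 1) {v p p' : ℝ → ℝ}
    (hv : ∀ r > 0, HasDerivAt v (r * p r) r) (hp : ∀ r > 0, HasDerivAt p (p' r) r)
    (hp' : ContinuousOn p' (Set.Ioi 0)) (hvpos : ∀ r > 0, 0 < v r)
    (hode : ∀ r > 0, r * p' r + (2 - 2 * ρ) * p r
      + lam * (v r ^ τ * |r * p r| ^ (1 - τ) / r ^ (τ + 1)) = r ^ θ * v r ^ q) :
    IsSolutionE N ρ lam τ θ q Set.univ (fun x : 𝔼 => v ‖x‖) := by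
  have hpC : ContDiffOn ℝ 1 p (Set.Ioi 0) := contDiffOn_one_of_hasDerivAt isOpen_Ioi hp hp'
  have hvC : ContDiffOn ℝ 1 v (Set.Ioi 0) :=
    contDiffOn_one_of_hasDerivAt isOpen_Ioi hv (continuousOn_id.mul hpC.continuousOn)
  have hP : PosC1 Set.univ (fun x : 𝔼 => v ‖x‖) := by
    refine ⟨?_, fun x hx => hvpos _ (norm_pos_iff.2 hx.2)⟩
    rw [← Set.compl_eq_univ_sdiff]
    exact contDiffAt_comp_norm hvC
  have hgrad : ∀ x : 𝔼, x ≠ 0 → gradient (fun x : 𝔼 => v ‖x‖) x = p ‖x‖ • x := by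
    intro x hx
    have hx' := norm_pos_iff.2 hx
    refine ext_inner_left ℝ fun y => ?_
    rw [inner_gradient_eq_fderiv, (hasFDerivAt_comp_norm hx (hv _ hx')).fderiv]
    rw [mul_div_cancel_left₀ _ hx'.ne', real_inner_smul_right, real_inner_comm]
    simp
  have hae : ∀ᵐ y : 𝔼, y ≠ 0 := Measure.ae_ne volume 0
  refine ⟨hP, fun φ hφ => ?_⟩
  rw [weakE_eq ρ lam θ q hτ1 hP hφ]
  obtain ⟨hφ1, hφc, hφs⟩ := hφ
  rw [← Set.compl_eq_univ_sdiff] at hφs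
  have h1 : ∫ x, ⟪gradient (fun x : 𝔼 => v ‖x‖) x, gradient φ x⟫ =
      ∫ x, ⟪p ‖x‖ • x, gradient φ x⟫ := by
    refine integral_congr_ae ?_
    filter_upwards [hae] with x hx
    rw [hgrad x hx]
  rw [h1, integral_inner_gradient_eq_neg (X := fun x : 𝔼 => p ‖x‖ • x) isOpen_compl_singleton
    ((contDiffAt_comp_norm hpC).smul contDiffOn_id) hφ1 hφc hφs, sub_eq_zero, ← integral_neg]
  refine integral_congr_ae ?_
  filter_upwards [hae] with x hx
  have hx' := norm_pos_iff.2 hx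
  have hdiv : (∑ i, fderiv ℝ (fun y : 𝔼 => (p ‖y‖ • y) i) x (EuclideanSpace.single i 1)) =
      ‖x‖ * p' ‖x‖ + N * p ‖x‖ := by
    have hi : ∀ i : Fin N, fderiv ℝ (fun y : 𝔼 => (p ‖y‖ • y) i) x (EuclideanSpace.single i 1) =
        p' ‖x‖ / ‖x‖ * (x i) ^ 2 + p ‖x‖ := by
      intro i
      have h := (hasFDerivAt_comp_norm hx (hp _ hx')).mul
        ((EuclideanSpace.proj (𝕜 := ℝ) i : 𝔼 →L[ℝ] ℝ).hasFDerivAt (x := x))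
      have h' : HasFDerivAt (fun y : 𝔼 => (p ‖y‖ • y) i) _ x := h
      rw [h'.fderiv]
      simp [EuclideanSpace.inner_single_right]
      ring
    rw [Finset.sum_congr rfl fun i _ => hi i, Finset.sum_add_distrib, ← Finset.mul_sum,
      ← EuclideanSpace.real_norm_sq_eq]
    simp
    field_simp
  rw [hdiv]
  have hO := hode _ hx'
  unfold lowerOrder Gt
  rw [hgrad x hx, ← hO, norm_smul, real_inner_smul_right, real_inner_self_eq_norm_sq, abs_mul,
    abs_of_pos hx', Real.norm_eq_abs, mul_comm ‖x‖ |p ‖x‖|]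
  field_simp
  ring

end Radial

section Peano

open Set NNReal

lemma exists_tendsto_subseq_of_lipschitz {a b R : ℝ} {L : ℝ≥0} {E : ℕ → ℝ → ℝ}
    (hE : ∀ n, LipschitzOnWith L (E n) (Icc a b)) (hR : ∀ n, ∀ t ∈ Icc a b, |E n t| ≤ R) :
    ∃ (ψ : ℕ → ℕ) (e : ℝ → ℝ), StrictMono ψ ∧ ContinuousOn e (Icc a b) ∧
      ∀ t ∈ Icc a b, Tendsto (fun n => E (ψ n) t) atTop (𝓝 (e t)) := by
  have hLip : ∀ n, LipschitzWith L (fun t : Icc a b => E n t) := fun n => (hE n).to_restrict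
  let f : ℕ → BoundedContinuousFunction (Icc a b) ℝ := fun n =>
    BoundedContinuousFunction.mkOfCompact ⟨fun t : Icc a b => E n t, (hLip n).continuous⟩
  have hcomp : IsCompact (closure (range f)) := by
    refine BoundedContinuousFunction.arzela_ascoli (Icc (-R) R) isCompact_Icc _ ?_ ?_
    · rintro _ x ⟨n, rfl⟩
      exact abs_le.1 (hR n x x.2)
    · refine (LipschitzWith.uniformEquicontinuous _ L ?_).equicontinuous
      rintro ⟨_, n, rfl⟩
      exact hLip n
  obtain ⟨e, -, ψ, hψ, he⟩ := hcomp.tendsto_subseq (fun n => subset_closure (mem_range_self n))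
  refine ⟨ψ, fun t => if h : t ∈ Icc a b then e ⟨t, h⟩ else 0, hψ, ?_, ?_⟩
  · rw [continuousOn_iff_continuous_domRestrict]
    convert e.continuous using 1
    funext t
    simp [t.2.1, t.2.2]
  · intro t ht
    have h1 : Tendsto (fun n => (f (ψ n)) ⟨t, ht⟩) atTop (𝓝 (e ⟨t, ht⟩)) :=
      (BoundedContinuousFunction.tendsto_iff_tendstoUniformly.1 he).tendsto_at _
    simp only [ht, dif_pos]
    exact h1

/-- Existence for a scalar equation whose right-hand side is a limit of bounded Lipschitz ones. -/
lemma exists_solution_of_lipschitz_approx {a b : ℝ} (hab : a ≤ b) {L : ℝ≥0}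
    {f : ℝ → ℝ → ℝ} {F : ℕ → ℝ → ℝ → ℝ}
    (hf : ContinuousOn (Function.uncurry f) (Icc a b ×ˢ univ))
    (hF : ∀ n, ContinuousOn (Function.uncurry (F n)) (Icc a b ×ˢ univ))
    (hlip : ∀ n, ∃ K : ℝ≥0, ∀ t ∈ Icc a b, LipschitzWith K (F n t))
    (hL : ∀ n, ∀ t ∈ Icc a b, ∀ x, |F n t x| ≤ L)
    {ε : ℕ → ℝ} (hε : Tendsto ε atTop (𝓝 0))
    (hfF : ∀ n, ∀ t ∈ Icc a b, ∀ x, |F n t x - f t x| ≤ ε n) :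
    ∃ e : ℝ → ℝ, e a = 0 ∧ ∀ t ∈ Icc a b, HasDerivWithinAt e (f t (e t)) (Icc a b) t := by
  have hsol : ∀ n, ∃ α : ℝ → ℝ, α a = 0 ∧
      ∀ t ∈ Icc a b, HasDerivWithinAt α (F n t (α t)) (Icc a b) t := by
    intro n
    obtain ⟨K, hK⟩ := hlip n
    have hPL : IsPicardLindelof (F n) (⟨a, left_mem_Icc.2 hab⟩ : Icc a b) (0 : ℝ)
        (L * Real.toNNReal (b - a)) 0 L K := by
      refine ⟨fun t ht => (hK t ht).lipschitzOnWith, fun x _ => ?_, fun t ht x _ => hL n t ht x, ?_⟩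
      · exact (hF n).comp (f := fun t => (t, x)) (by fun_prop) fun t ht => ⟨ht, mem_univ _⟩
      · simp [Real.coe_toNNReal _ (sub_nonneg.2 hab), hab]
    exact hPL.exists_eq_forall_mem_Icc_hasDerivWithinAt₀
  choose E hE0 hE using hsol
  have hElip : ∀ n, LipschitzOnWith L (E n) (Icc a b) := fun n =>
    (convex_Icc a b).lipschitzOnWith_of_nnnorm_hasDerivWithin_le (hE n) fun t ht => by
      rw [← NNReal.coe_le_coe]; exact hL n t ht _
  have hEcont : ∀ n, ContinuousOn (E n) (Icc a b) := fun n => (hElip n).continuousOn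
  have haI : a ∈ Icc a b := left_mem_Icc.2 hab
  have hER : ∀ n, ∀ t ∈ Icc a b, |E n t| ≤ L * (b - a) := fun n t ht => by
    have := (hElip n).dist_le_mul t ht a haI
    rw [hE0 n, Real.dist_eq, sub_zero, Real.dist_eq, 
      abs_of_nonneg (by linarith [ht.1] : 0 ≤ t - a)] at this
    exact this.trans (mul_le_mul_of_nonneg_left (by linarith [ht.2]) L.2)
  obtain ⟨ψ, e, hψ, hec, he⟩ := exists_tendsto_subseq_of_lipschitz hElip hER
  have hcomp : ∀ {g : ℝ → ℝ → ℝ} {α : ℝ → ℝ},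
      ContinuousOn (Function.uncurry g) (Icc a b ×ˢ univ) → ContinuousOn α (Icc a b) →
      ContinuousOn (fun t => g t (α t)) (Icc a b) := fun hg hα =>
    hg.comp (f := fun t => (t, _)) (continuousOn_id.prodMk hα) fun t ht => ⟨ht, mem_univ _⟩
  have hintegral : ∀ n, ∀ t ∈ Icc a b, E n t = ∫ s in a..t, F n s (E n s) := by
    intro n t ht
    have hsub : Icc a t ⊆ Icc a b := Icc_subset_Icc_right ht.2
    rw [intervalIntegral.integral_eq_sub_of_hasDeriv_right_of_le ht.1
      ((hEcont n).mono hsub) (f' := fun s => F n s (E n s)), hE0 n, sub_zero]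
    · intro s hs
      refine (hE n s (hsub (Ioo_subset_Icc_self hs))).mono_of_mem_nhdsWithin ?_
      refine mem_nhdsWithin_of_mem_nhds (Icc_mem_nhds hs.1 (hs.2.trans_le ht.2))
    · refine ContinuousOn.intervalIntegrable ?_
      rw [uIcc_of_le ht.1]
      exact (hcomp (hF n) (hEcont n)).mono hsub
  have hlim : ∀ t ∈ Icc a b, e t = ∫ s in a..t, f s (e s) := by
    intro t ht
    refine tendsto_nhds_unique (he t ht) ?_
    have hsub : uIoc a t ⊆ Icc a b := by
      rw [uIoc_of_le ht.1]
      exact Ioc_subset_Icc_self.trans (Icc_subset_Icc_right ht.2)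
    rw [show (fun n => E (ψ n) t) = fun n => ∫ s in a..t, F (ψ n) s (E (ψ n) s) from
      funext fun n => hintegral _ t ht]
    refine intervalIntegral.tendsto_integral_filter_of_dominated_convergence (fun _ => (L : ℝ))
      (Eventually.of_forall fun n => ?_) (Eventually.of_forall fun n => ?_) (by simp) ?_
    · exact ((hcomp (hF _) (hEcont _)).mono hsub).aestronglyMeasurable measurableSet_uIoc
    · exact Eventually.of_forall fun s hs => hL _ s (hsub hs) _
    · refine Eventually.of_forall fun s hs => ?_
      have hs' := hsub hs
      have h1 : Tendsto (fun n => f s (E (ψ n) s)) atTop (𝓝 (f s (e s))) := by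
        have hc : Continuous (f s) := by
          rw [← continuousOn_univ]
          exact hf.comp (f := fun x => (s, x)) (by fun_prop) fun x _ => ⟨hs', mem_univ _⟩
        exact (hc.tendsto _).comp (he s hs')
      have h2 : Tendsto (fun n => F (ψ n) s (E (ψ n) s) - f s (E (ψ n) s)) atTop (𝓝 0) :=
        squeeze_zero_norm (fun n => hfF _ s hs' _) (hε.comp hψ.tendsto_atTop)
      simpa using h2.add h1
  refine ⟨e, by simpa using hlim a haI, fun t ht => ?_⟩
  have := ODE.hasDerivWithinAt_picard_Icc haI hf hec (fun _ _ => mem_univ _) 0 ht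
  refine this.congr (fun s hs => ?_) ?_
  · simp [ODE.picard_apply, hlim s hs]
  · simp [ODE.picard_apply, hlim t ht]

lemma abs_sqrt_sub_sqrt_le {x y c : ℝ} (hc : 0 < c) (hx : c ≤ x) (hy : c ≤ y) :
    |√x - √y| ≤ 1 / (2 * √c) * |x - y| := by
  have hc' := Real.sqrt_pos.2 hc
  have h1 := Real.sqrt_le_sqrt hx
  have h2 := Real.sqrt_le_sqrt hy
  have h3 : (√x - √y) * (√x + √y) = x - y := by
    rw [mul_comm, ← sq_sub_sq, Real.sq_sqrt (hc.le.trans hx), Real.sq_sqrt (hc.le.trans hy)]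
  rw [← h3, abs_mul, abs_of_nonneg (by linarith : 0 ≤ √x + √y), one_div, inv_mul_eq_div,
    le_div_iff₀ (by positivity)]
  exact mul_le_mul_of_nonneg_left (by linarith) (abs_nonneg _)

/-- Existence for `e' = A min(√(2e), M) + B`, `e(a) = 0`. -/
lemma exists_sqrt_ode {a b M : ℝ} (hab : a ≤ b) (hM : 0 ≤ M) {A B : ℝ → ℝ}
    (hA : ContinuousOn A (Icc a b)) (hB : ContinuousOn B (Icc a b)) :
    ∃ e : ℝ → ℝ, e a = 0 ∧
      ∀ t ∈ Icc a b, HasDerivWithinAt e (A t * min √(2 * e t) M + B t) (Icc a b) t := by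
  obtain ⟨CA, hCA⟩ := isCompact_Icc.exists_bound_of_continuousOn hA
  obtain ⟨CB, hCB⟩ := isCompact_Icc.exists_bound_of_continuousOn hB
  have haI : a ∈ Icc a b := left_mem_Icc.2 hab
  have hCA0 : 0 ≤ CA := (norm_nonneg _).trans (hCA a haI)
  have hCB0 : 0 ≤ CB := (norm_nonneg _).trans (hCB a haI)
  set c : ℕ → ℝ := fun n => 1 / ((n : ℝ) + 1) with hc
  have hcpos : ∀ n, 0 < c n := fun n => by positivity
  set g : ℕ → ℝ → ℝ := fun n x => min √(max (2 * x) 0 + c n) M with hg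
  have hg0 : ∀ n x, |g n x| ≤ M := fun n x => by
    rw [abs_of_nonneg (le_min (Real.sqrt_nonneg _) hM)]
    exact min_le_right _ _
  have hcont : ∀ {h : ℝ → ℝ}, Continuous h →
      ContinuousOn (Function.uncurry fun t x => A t * h x + B t) (Icc a b ×ˢ univ) := fun hh =>
    ((hA.comp continuousOn_fst fun p hp => hp.1).mul
      (hh.comp continuous_snd).continuousOn).add (hB.comp continuousOn_fst fun p hp => hp.1)
  have hmin : ∀ x y : ℝ, |min x M - min y M| ≤ |x - y| := fun x y => by
    simpa using abs_min_sub_min_le_max x M y M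
  refine exists_solution_of_lipschitz_approx (f := fun t x => A t * min √(2 * x) M + B t)
    (F := fun n t x => A t * g n x + B t) (L := ⟨CA * M + CB, by positivity⟩)
    (ε := fun n => CA * √(c n)) hab (hcont (by fun_prop)) (fun n => hcont (by fun_prop)) ?_ ?_ ?_ ?_
  · intro n
    refine ⟨Real.toNNReal (CA * (1 / (2 * √(c n)) * 2)), fun t ht => ?_⟩
    refine LipschitzWith.of_dist_le_mul fun x y => ?_
    have h0 : 0 ≤ 1 / (2 * √(c n)) := by positivity
    rw [Real.coe_toNNReal _ (by positivity), Real.dist_eq, Real.dist_eq]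
    have h1 : |g n x - g n y| ≤ 1 / (2 * √(c n)) * (2 * |x - y|) := by
      refine (hmin _ _).trans ((abs_sqrt_sub_sqrt_le (hcpos n) ?_ ?_).trans ?_)
      · linarith [le_max_right (2 * x) 0]
      · linarith [le_max_right (2 * y) 0]
      · refine mul_le_mul_of_nonneg_left ?_ h0
        have := abs_max_sub_max_le_max (2 * x) 0 (2 * y) 0
        simp only [sub_self, abs_zero, abs_nonneg, max_eq_left] at this
        rw [add_sub_add_right_eq_sub]
        refine this.trans (le_of_eq ?_)
        rw [← mul_sub, abs_mul, abs_two]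
    calc |A t * g n x + B t - (A t * g n y + B t)| = |A t| * |g n x - g n y| := by
          rw [add_sub_add_right_eq_sub, ← mul_sub, abs_mul]
      _ ≤ CA * (1 / (2 * √(c n)) * (2 * |x - y|)) :=
          mul_le_mul (hCA t ht) h1 (abs_nonneg _) hCA0
      _ = _ := by ring
  · intro n t ht x
    refine (abs_add_le _ _).trans (add_le_add ?_ (hCB t ht))
    rw [abs_mul]
    exact mul_le_mul (hCA t ht) (hg0 n x) (abs_nonneg _) hCA0
  · have h1 : Tendsto c atTop (𝓝 0) := tendsto_one_div_add_atTop_nhds_zero_nat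
    simpa using (h1.sqrt).const_mul CA
  · intro n t ht x
    rw [add_sub_add_right_eq_sub, ← mul_sub, abs_mul]
    refine mul_le_mul (hCA t ht) ((hmin _ _).trans ?_) (abs_nonneg _) hCA0
    have h2 : √(2 * x) = √(max (2 * x) 0) := by
      rcases le_total (2 * x) 0 with h | h
      · rw [max_eq_right h, Real.sqrt_eq_zero_of_nonpos h, Real.sqrt_zero]
      · rw [max_eq_left h]
    have h0 : 0 ≤ max (2 * x) 0 := le_max_right _ _
    rw [h2, abs_of_nonneg (sub_nonneg.2 (Real.sqrt_le_sqrt (by linarith [hcpos n])))]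
    have : √(max (2 * x) 0 + c n) ≤ √(max (2 * x) 0) + √(c n) := by
      refine Real.sqrt_le_iff.2 ⟨by positivity, ?_⟩
      nlinarith [Real.sq_sqrt h0, Real.sq_sqrt (hcpos n).le, Real.sqrt_nonneg (max (2 * x) 0),
        Real.sqrt_nonneg (c n), mul_nonneg (Real.sqrt_nonneg (max (2 * x) 0))
        (Real.sqrt_nonneg (c n))]
    linarith

end Peano

section PhasePlane

open Set

/-- A function controlled by its own derivative that is positive at `a` stays positive. -/
lemma pos_of_abs_deriv_le_mul_abs {a b K : ℝ} {J J' : ℝ → ℝ}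
    (hJ : ∀ t ∈ Icc a b, HasDerivWithinAt J (J' t) (Icc a b) t)
    (hK : ∀ t ∈ Icc a b, |J' t| ≤ K * |J t|) (ha : 0 < J a) : ∀ t ∈ Icc a b, 0 < J t := by
  intro t ht
  by_contra! hneg
  have hcont : ContinuousOn J (Icc a b) := fun x hx => (hJ x hx).continuousWithinAt
  have hsub : Icc a t ⊆ Icc a b := Icc_subset_Icc_right ht.2
  obtain ⟨z, hz, hz0⟩ := intermediate_value_Icc' ht.1 (hcont.mono hsub) ⟨hneg, ha.le⟩
  have hzb := hsub hz
  have hmap : ∀ x ∈ Icc (-z) (-a), -x ∈ Icc a b := fun x hx =>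
    ⟨by linarith [hx.2], by linarith [hx.1, hzb.2]⟩
  have key : ∀ x ∈ Icc (-z) (-a), J (-x) = 0 := by
    refine eq_zero_of_abs_deriv_le_mul_abs_self_of_eq_zero_right (f := fun x => J (-x))
      (f' := fun x => -J' (-x)) (K := K) ?_ ?_ (by simpa using hz0) ?_
    · exact hcont.comp continuousOn_neg hmap
    · intro x hx
      have h1 := hJ (-x) (hmap x (Ico_subset_Icc_self hx))
      have h3 : HasDerivWithinAt (fun x : ℝ => -x) (-1) (Icc x (-a)) x :=
        (hasDerivAt_neg x).hasDerivWithinAt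
      have h4 := h1.comp x h3 fun y hy => hmap y ⟨hx.1.trans hy.1, hy.2⟩
      have h5 := h4.mono_of_mem_nhdsWithin (Icc_mem_nhdsGE hx.2)
      simpa [Function.comp_def] using h5
    · intro x hx
      simpa using hK (-x) (hmap x (Ico_subset_Icc_self hx))
  have := key (-a) ⟨by linarith [hz.1], le_rfl⟩
  rw [neg_neg] at this
  exact ha.ne' this

/-- The trajectory joining the rest points of `k' = Z - F(k)`, `Z' = m (k - κ) Z`, written as a
graph `Z = F - D` over the `k`-axis. -/
lemma exists_phase_profile {κ k₂ m : ℝ} (hk : κ < k₂) (hm : 0 < m) {F F' : ℝ → ℝ}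
    (hF : ∀ k ∈ Icc κ k₂, HasDerivAt F (F' k) k) (hF' : ContinuousOn F' (Icc κ k₂))
    (hpos : ∀ k ∈ Ico κ k₂, 0 < F k) (hz : F k₂ = 0) :
    ∃ D : ℝ → ℝ, ∃ C > 0, ContinuousOn D (Icc κ k₂) ∧ D κ = 0 ∧ ∀ k ∈ Ioo κ k₂,
      0 < D k ∧ D k < F k ∧ D k ≤ C * (k - κ) ∧ D k ≤ C * (k₂ - k) ∧
      HasDerivAt D (F' k + m * (k - κ) * (F k - D k) / D k) k := by
  have hFc : ContinuousOn F (Icc κ k₂) := fun k hk => (hF k hk).continuousAt.continuousWithinAt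
  have hκI : κ ∈ Icc κ k₂ := left_mem_Icc.2 hk.le
  obtain ⟨M, hM⟩ := isCompact_Icc.exists_bound_of_continuousOn hFc
  obtain ⟨C₀, hC₀⟩ := isCompact_Icc.exists_bound_of_continuousOn hF'
  have hM0 : 0 ≤ M := (norm_nonneg _).trans (hM κ hκI)
  have hC₀0 : 0 ≤ C₀ := (norm_nonneg _).trans (hC₀ κ hκI)
  have hFM : ∀ k ∈ Icc κ k₂, F k ≤ M := fun k hk => (le_abs_self _).trans (hM k hk)
  have hF0 : ∀ k ∈ Icc κ k₂, 0 ≤ F k := fun k hk => by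
    rcases hk.2.eq_or_lt with h | h
    · rw [h, hz]
    · exact (hpos k ⟨hk.1, h⟩).le
  set A : ℝ → ℝ := fun k => F' k - m * (k - κ) with hAdef
  set B : ℝ → ℝ := fun k => m * (k - κ) * F k with hBdef
  have hA : ContinuousOn A (Icc κ k₂) := hF'.sub (by fun_prop)
  have hB : ContinuousOn B (Icc κ k₂) := ContinuousOn.mul (by fun_prop) hFc
  obtain ⟨C₁, hC₁⟩ := isCompact_Icc.exists_bound_of_continuousOn hA
  have hC₁0 : 0 ≤ C₁ := (norm_nonneg _).trans (hC₁ κ hκI)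
  obtain ⟨e, he0, he⟩ := exists_sqrt_ode hk.le hM0 hA hB
  have hec : ContinuousOn e (Icc κ k₂) := fun x hx => (he x hx).continuousWithinAt
  have hed : ∀ k ∈ Ioo κ k₂, HasDerivAt e (A k * min √(2 * e k) M + B k) k := fun k hk =>
    (he k (Ioo_subset_Icc_self hk)).hasDerivAt (Icc_mem_nhds hk.1 hk.2)
  -- positivity of `e`
  have hepos : ∀ k ∈ Ioo κ k₂, 0 < e k := by
    intro k₁ hk₁
    by_contra! hneg
    have hsub : Icc κ k₁ ⊆ Icc κ k₂ := Icc_subset_Icc_right hk₁.2.le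
    obtain ⟨x, hx, hxmin⟩ := isCompact_Icc.exists_isMinOn (nonempty_Icc.2 hk₁.1.le)
      (hec.mono hsub)
    obtain ⟨y, hy, hymin⟩ : ∃ y ∈ Ioc κ k₁, ∀ z ∈ Icc κ k₁, e y ≤ e z := by
      rcases hx.1.eq_or_lt with h | h
      · refine ⟨k₁, ⟨hk₁.1, le_rfl⟩, fun z hz => hneg.trans ?_⟩
        rw [← he0, h]
        exact hxmin hz
      · exact ⟨x, ⟨h, hx.2⟩, fun z hz => hxmin hz⟩
    have hy0 : e y ≤ 0 := (hymin k₁ ⟨hk₁.1.le, le_rfl⟩).trans hneg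
    have hy2 : y < k₂ := hy.2.trans_lt hk₁.2
    have hd := hed y ⟨hy.1, hy2⟩
    rw [Real.sqrt_eq_zero_of_nonpos (by linarith), min_eq_left hM0, mul_zero, zero_add] at hd
    have hBy : 0 < B y := mul_pos (mul_pos hm (sub_pos.2 hy.1)) (hpos y ⟨hy.1.le, hy2⟩)
    have hsl := (hasDerivAt_iff_tendsto_slope.1 hd).eventually (lt_mem_nhds hBy)
    have hsl' : ∀ᶠ z in 𝓝[<] y, 0 < slope e y z :=
      hsl.filter_mono (nhdsWithin_mono _ fun z hz => ne_of_lt hz)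
    obtain ⟨z, hz1, hz2⟩ := (hsl'.and (Ioo_mem_nhdsLT hy.1)).exists
    rw [slope_def_field] at hz1
    have h1 := hymin z ⟨hz2.1.le, hz2.2.le.trans hy.2⟩
    have h2 : (e z - e y) / (z - y) ≤ 0 :=
      div_nonpos_of_nonneg_of_nonpos (by linarith) (by linarith [hz2.2])
    linarith
  have hecl : ∀ k ∈ Ico κ k₂, 0 ≤ e k := fun k hk => by
    rcases hk.1.eq_or_lt with h | h
    · rw [← h, he0]
    · exact (hepos k ⟨h, hk.2⟩).le
  -- the trajectory lies below the graph of `F`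
  have hlt : ∀ k ∈ Ico κ k₂, √(2 * e k) < F k := by
    intro k₁ hk₁
    have hsub : Icc κ k₁ ⊆ Icc κ k₂ := Icc_subset_Icc_right hk₁.2.le
    have hFpos : ∀ k ∈ Icc κ k₁, 0 < F k := fun k hk => hpos k ⟨hk.1, hk.2.trans_lt hk₁.2⟩
    obtain ⟨x, hx, hxmin⟩ := isCompact_Icc.exists_isMinOn (nonempty_Icc.2 hk₁.1)
      (hFc.mono hsub)
    have hJ := pos_of_abs_deriv_le_mul_abs (a := κ) (b := k₁) (K := C₁ * (2 / F x))
      (J := fun k => F k ^ 2 / 2 - e k)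
      (J' := fun k => A k * (F k - min √(2 * e k) M)) ?_ ?_ ?_ k₁ ⟨hk₁.1, le_rfl⟩
    · have h1 := hFpos k₁ ⟨hk₁.1, le_rfl⟩
      refine (Real.sqrt_lt' h1).2 ?_
      linarith
    · intro k hk
      have h1 := (((hF k (hsub hk)).hasDerivWithinAt (s := Icc κ k₁)).pow 2).div_const 2
      refine (h1.sub ((he k (hsub hk)).mono hsub)).congr_deriv ?_
      simp only [hAdef, hBdef]
      push_cast
      ring
    · intro k hk
      have hFk := hFpos k hk
      have hek := hecl k ⟨hk.1, hk.2.trans_lt hk₁.2⟩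
      have hFx : F x ≤ F k := hxmin hk
      have hD0 := Real.sqrt_nonneg (2 * e k)
      have hD2 := Real.sq_sqrt (by linarith : 0 ≤ 2 * e k)
      have h1 : |F k - min √(2 * e k) M| ≤ |F k - √(2 * e k)| := by
        rcases le_total √(2 * e k) M with h | h
        · rw [min_eq_left h]
        · have hk' := hFM k (hsub hk)
          rw [min_eq_right h, abs_of_nonpos (by linarith), abs_of_nonpos (by linarith)]
          linarith
      have h2 : |F k - √(2 * e k)| ≤ 2 / F x * |F k ^ 2 / 2 - e k| := by
        have h3 : F k ^ 2 / 2 - e k = (F k - √(2 * e k)) * ((F k + √(2 * e k)) / 2) := by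
          nlinarith
        rw [h3, abs_mul, abs_of_pos (by positivity : 0 < (F k + √(2 * e k)) / 2)]
        have h4 : 1 ≤ 2 / F x * ((F k + √(2 * e k)) / 2) := by
          rw [div_mul_div_comm, le_div_iff₀ (by linarith [hFpos x hx])]
          nlinarith
        nlinarith [abs_nonneg (F k - √(2 * e k))]
      rw [abs_mul, mul_assoc]
      exact mul_le_mul (hC₁ k (hsub hk)) (h1.trans h2) (abs_nonneg _) hC₁0
    · have := hpos κ ⟨le_rfl, hk⟩
      rw [he0, sub_zero]
      positivity
  have hmin : ∀ k ∈ Ico κ k₂, min √(2 * e k) M = √(2 * e k) := fun k hk =>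
    min_eq_left ((hlt k hk).le.trans (hFM k (Ico_subset_Icc_self hk)))
  have hDc : ContinuousOn (fun k => √(2 * e k)) (Icc κ k₂) := (continuousOn_const.mul hec).sqrt
  set C : ℝ := C₀ + (2 * C₁ + 2 * (m * M) + 1) with hC
  have hCpos : 0 < C := by positivity
  refine ⟨fun k => √(2 * e k), C, hCpos, hDc, by simp [he0], fun k hkI => ?_⟩
  have hDpos : 0 < √(2 * e k) := Real.sqrt_pos.2 (by linarith [hepos k hkI])
  refine ⟨hDpos, hlt k (Ioo_subset_Ico_self hkI), ?_, ?_, ?_⟩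
  · have hsub : Icc κ k ⊆ Icc κ k₂ := Icc_subset_Icc_right hkI.2.le
    obtain ⟨x, hx, hxmax⟩ := isCompact_Icc.exists_isMaxOn (nonempty_Icc.2 hkI.1.le)
      (hDc.mono hsub)
    set S := √(2 * e x) with hS
    have hSmax : ∀ y ∈ Icc κ k, √(2 * e y) ≤ S := fun y hy => hxmax hy
    have hS0 : 0 ≤ S := Real.sqrt_nonneg _
    have hSsq : S ^ 2 = 2 * e x :=
      Real.sq_sqrt (by linarith [hecl x ⟨hx.1, hx.2.trans_lt hkI.2⟩])
    have hh : 0 < k - κ := sub_pos.2 hkI.1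
    have hmv := (convex_Icc κ k).norm_image_sub_le_of_norm_hasDerivWithin_le
      (C := C₁ * S + m * M * (k - κ)) (fun y hy => (he y (hsub hy)).mono hsub) ?_
      (left_mem_Icc.2 hkI.1.le) hx
    · rw [he0, sub_zero, Real.norm_eq_abs, Real.norm_eq_abs,
        abs_of_nonneg (sub_nonneg.2 hx.1)] at hmv
      have h1 : S ^ 2 ≤ 2 * ((C₁ * S + m * M * (k - κ)) * (k - κ)) := by
        have h2 : (C₁ * S + m * M * (k - κ)) * (x - κ) ≤
            (C₁ * S + m * M * (k - κ)) * (k - κ) :=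
          mul_le_mul_of_nonneg_left (by linarith [hx.2]) (by positivity)
        linarith [le_abs_self (e x)]
      have h3 : √(2 * e k) ≤ S := hSmax k (right_mem_Icc.2 hkI.1.le)
      refine h3.trans ?_
      by_contra! hcon
      have hSh : k - κ ≤ S := by nlinarith [mul_nonneg hm.le hM0]
      have hmM := mul_nonneg hm.le hM0
      have h4 : m * M * (k - κ) * (k - κ) ≤ m * M * (k - κ) * S :=
        mul_le_mul_of_nonneg_left hSh (by positivity)
      have h5 : C * (k - κ) * S < S * S := mul_lt_mul_of_pos_right hcon (hh.trans_le hSh)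
      have h6 : C * (k - κ) * S = C₀ * ((k - κ) * S) + 2 * (C₁ * S * (k - κ)) +
        2 * (m * M * (k - κ) * S) + (k - κ) * S := by rw [hC]; ring
      have h7 : 0 ≤ C₀ * ((k - κ) * S) := by positivity
      nlinarith [mul_pos hh (hh.trans_le hSh)]
    · intro y hy
      have hy' : y ∈ Ico κ k₂ := ⟨hy.1, hy.2.trans_lt hkI.2⟩
      rw [hmin y hy']
      refine (norm_add_le _ _).trans (add_le_add ?_ ?_)
      · rw [norm_mul, Real.norm_eq_abs √_, abs_of_nonneg (Real.sqrt_nonneg _)]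
        exact mul_le_mul (hC₁ y (hsub hy)) (hSmax y hy) (Real.sqrt_nonneg _) hC₁0
      · have hy0 : 0 ≤ y - κ := sub_nonneg.2 hy.1
        rw [Real.norm_eq_abs, abs_of_nonneg (mul_nonneg (mul_nonneg hm.le hy0) (hF0 y (hsub hy)))]
        calc m * (y - κ) * F y ≤ m * (k - κ) * M :=
              mul_le_mul (mul_le_mul_of_nonneg_left (by linarith [hy.2]) hm.le) (hFM y (hsub hy))
                (hF0 y (hsub hy)) (by positivity)
          _ = m * M * (k - κ) := by ring
  · have hmv := (convex_Icc κ k₂).norm_image_sub_le_of_norm_hasDerivWithin_le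
      (fun y hy => (hF y hy).hasDerivWithinAt) hC₀ (right_mem_Icc.2 hk.le)
      (Ioo_subset_Icc_self hkI)
    rw [hz, sub_zero, Real.norm_eq_abs, Real.norm_eq_abs, abs_sub_comm,
      abs_of_pos (sub_pos.2 hkI.2)] at hmv
    have h1 := hlt k (Ioo_subset_Ico_self hkI)
    have h2 : C₀ * (k₂ - k) ≤ C * (k₂ - k) := by
      refine mul_le_mul_of_nonneg_right ?_ (sub_nonneg.2 hkI.2.le)
      have := mul_nonneg hm.le hM0
      linarith
    simp only
    linarith [le_abs_self (F k)]
  · have hd := hed k hkI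
    rw [hmin k (Ioo_subset_Ico_self hkI)] at hd
    refine ((hd.const_mul 2).sqrt (by linarith [hepos k hkI])).congr_deriv ?_
    simp only [hAdef, hBdef]
    field_simp
    ring

end PhasePlane

section Inversion

open Set

lemma tendsto_log_sub_nhdsLT (c : ℝ) : Tendsto (fun x => Real.log (c - x)) (𝓝[<] c) atBot := by
  refine Real.tendsto_log_nhdsGT_zero.comp (tendsto_nhdsWithin_iff.2 ⟨?_, ?_⟩)
  · have : Tendsto (fun x => c - x) (𝓝 c) (𝓝 (c - c)) := by
      exact (continuous_const.sub continuous_id).tendsto c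
    rw [sub_self] at this
    exact this.mono_left nhdsWithin_le_nhds
  · filter_upwards [self_mem_nhdsWithin] with x hx
    exact sub_pos.2 (mem_Iio.1 hx)

lemma tendsto_log_sub_nhdsGT (c : ℝ) : Tendsto (fun x => Real.log (x - c)) (𝓝[>] c) atBot := by
  refine Real.tendsto_log_nhdsGT_zero.comp (tendsto_nhdsWithin_iff.2 ⟨?_, ?_⟩)
  · have : Tendsto (fun x => x - c) (𝓝 c) (𝓝 (c - c)) := by
      exact (continuous_id.sub continuous_const).tendsto c
    rw [sub_self] at this
    exact this.mono_left nhdsWithin_le_nhds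
  · filter_upwards [self_mem_nhdsWithin] with x hx
    exact sub_pos.2 (mem_Ioi.1 hx)

/-- A global solution of the scalar equation `k' = -D(k)` crossing the whole interval `(a, b)`. -/
lemma exists_global_flow {a b C : ℝ} (hab : a < b) (hC : 0 < C) {D : ℝ → ℝ}
    (hD : ContinuousOn D (Ioo a b)) (hpos : ∀ x ∈ Ioo a b, 0 < D x)
    (hDa : ∀ x ∈ Ioo a b, D x ≤ C * (x - a)) (hDb : ∀ x ∈ Ioo a b, D x ≤ C * (b - x)) :
    ∃ k : ℝ → ℝ, (∀ s, k s ∈ Ioo a b) ∧ (∀ s, HasDerivAt k (-D (k s)) s) ∧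
      Tendsto k atTop (𝓝 a) ∧ Tendsto k atBot (𝓝 b) := by
  obtain ⟨c, hc⟩ := exists_between hab
  have hcI : c ∈ Ioo a b := hc
  have hinv : ContinuousOn (fun x => 1 / D x) (Ioo a b) :=
    continuousOn_const.div hD fun x hx => (hpos x hx).ne'
  set S : ℝ → ℝ := fun x => ∫ t in c..x, 1 / D t with hS
  have hSd : ∀ x ∈ Ioo a b, HasDerivAt S (1 / D x) x := by
    intro x hx
    refine intervalIntegral.integral_hasDerivAt_right ?_ ?_ ?_
    · exact (hinv.mono (ordConnected_Ioo.uIcc_subset hcI hx)).intervalIntegrable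
    · exact ⟨Ioo a b, Ioo_mem_nhds hx.1 hx.2, hinv.aestronglyMeasurable measurableSet_Ioo⟩
    · exact hinv.continuousAt (Ioo_mem_nhds hx.1 hx.2)
  have hSc : ContinuousOn S (Ioo a b) := fun x hx => (hSd x hx).continuousAt.continuousWithinAt
  have hmono : StrictMonoOn S (Ioo a b) := by
    refine strictMonoOn_of_deriv_pos (convex_Ioo a b) hSc fun x hx => ?_
    rw [interior_Ioo] at hx
    rw [(hSd x hx).deriv]
    exact one_div_pos.2 (hpos x hx)
  have htop : Tendsto S (𝓝[<] b) atTop := by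
    have hm : MonotoneOn (fun x => S x + 1 / C * Real.log (b - x)) (Ioo a b) := by
      have hd : ∀ x ∈ Ioo a b, HasDerivAt (fun x => S x + 1 / C * Real.log (b - x))
          (1 / D x + 1 / C * (-1 / (b - x))) x := fun x hx =>
        (hSd x hx).add ((((hasDerivAt_id x).const_sub b).log (sub_pos.2 hx.2).ne').const_mul _)
      refine monotoneOn_of_deriv_nonneg (convex_Ioo a b)
        (fun x hx => (hd x hx).continuousAt.continuousWithinAt)
        (fun x hx => (hd x (interior_subset hx)).differentiableAt.differentiableWithinAt) ?_
      intro x hx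
      rw [interior_Ioo] at hx
      rw [(hd x hx).deriv]
      have h1 := one_div_le_one_div_of_le (hpos x hx) (hDb x hx)
      have h2 : 1 / C * (-1 / (b - x)) = -(1 / (C * (b - x))) := by
        rw [div_mul_div_comm, one_mul, neg_div]
      linarith
    have h1 : Tendsto (fun x => (S c + 1 / C * Real.log (b - c)) + -(1 / C * Real.log (b - x)))
        (𝓝[<] b) atTop :=
      tendsto_atTop_add_const_left _ _ (tendsto_neg_atBot_atTop.comp
        ((tendsto_log_sub_nhdsLT b).const_mul_atBot (one_div_pos.2 hC)))
    refine tendsto_atTop_mono' _ ?_ h1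
    filter_upwards [Ioo_mem_nhdsLT hc.2] with x hx
    have := hm hcI ⟨hc.1.trans hx.1, hx.2⟩ hx.1.le
    simp only at this
    linarith
  have hbot : Tendsto S (𝓝[>] a) atBot := by
    have hm : MonotoneOn (fun x => S x - 1 / C * Real.log (x - a)) (Ioo a b) := by
      have hd : ∀ x ∈ Ioo a b, HasDerivAt (fun x => S x - 1 / C * Real.log (x - a))
          (1 / D x - 1 / C * (1 / (x - a))) x := fun x hx =>
        (hSd x hx).sub ((((hasDerivAt_id x).sub_const a).log (sub_pos.2 hx.1).ne').const_mul _)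
      refine monotoneOn_of_deriv_nonneg (convex_Ioo a b)
        (fun x hx => (hd x hx).continuousAt.continuousWithinAt)
        (fun x hx => (hd x (interior_subset hx)).differentiableAt.differentiableWithinAt) ?_
      intro x hx
      rw [interior_Ioo] at hx
      rw [(hd x hx).deriv]
      have h1 := one_div_le_one_div_of_le (hpos x hx) (hDa x hx)
      have h2 : 1 / C * (1 / (x - a)) = 1 / (C * (x - a)) := by
        rw [div_mul_div_comm, one_mul]
      linarith
    have h1 : Tendsto (fun x => (S c - 1 / C * Real.log (c - a)) + 1 / C * Real.log (x - a))
        (𝓝[>] a) atBot :=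
      tendsto_atBot_add_const_left _ _
        ((tendsto_log_sub_nhdsGT a).const_mul_atBot (one_div_pos.2 hC))
    refine tendsto_atBot_mono' _ ?_ h1
    filter_upwards [Ioo_mem_nhdsGT hc.1] with x hx
    have := hm ⟨hx.1, hx.2.trans hc.2⟩ hcI hx.2.le
    simp only at this
    linarith
  let S' : Ioo a b → ℝ := fun x => S x
  have hS'mono : StrictMono S' := fun x y hxy => hmono x.2 y.2 hxy
  have hS'surj : Function.Surjective S' := by
    intro s
    obtain ⟨x, hx, hxI⟩ := ((hbot.eventually (eventually_le_atBot s)).and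
      (Ioo_mem_nhdsGT hab)).exists
    obtain ⟨y, hy, hyI⟩ := ((htop.eventually (eventually_ge_atTop s)).and
      (Ioo_mem_nhdsLT hab)).exists
    obtain ⟨z, hz, hzs⟩ := isPreconnected_Ioo.intermediate_value hxI hyI hSc ⟨hx, hy⟩
    exact ⟨⟨z, hz⟩, hzs⟩
  let o : Ioo a b ≃o ℝ := hS'mono.orderIsoOfSurjective S' hS'surj
  let K : ℝ → ℝ := fun s => o.symm s
  have hKc : Continuous K := continuous_subtype_val.comp o.symm.continuous
  have hKI : ∀ s, K s ∈ Ioo a b := fun s => (o.symm s).2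
  have hSK : ∀ s, S (K s) = s := fun s => o.apply_symm_apply s
  have hKd : ∀ s, HasDerivAt K (D (K s)) s := fun s => by
    have := HasDerivAt.of_local_left_inverse hKc.continuousAt (hSd (K s) (hKI s))
      (one_div_pos.2 (hpos _ (hKI s))).ne' (Eventually.of_forall hSK)
    simpa using this
  have hKmono : Monotone K := fun x y hxy => o.symm.monotone hxy
  have hrange : range K = Ioo a b := by
    ext x
    refine ⟨?_, fun hx => ⟨o ⟨x, hx⟩, ?_⟩⟩
    · rintro ⟨s, rfl⟩
      exact hKI s
    · simp [K]
  refine ⟨fun s => K (-s), fun s => hKI _, fun s => ?_, ?_, ?_⟩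
  · simpa [Function.comp_def] using (hKd (-s)).comp s (hasDerivAt_neg s)
  · exact (tendsto_atBot_isGLB hKmono (hrange ▸ isGLB_Ioo hab)).comp tendsto_neg_atTop_atBot
  · exact (tendsto_atTop_isLUB hKmono (hrange ▸ isLUB_Ioo hab)).comp tendsto_neg_atBot_atTop

/-- The heteroclinic orbit of `k' = Z - F(k)`, `Z' = m (k - κ) Z` from `(k₂, 0)` to `(κ, F κ)`. -/
lemma exists_heteroclinic {κ k₂ m : ℝ} (hk : κ < k₂) (hm : 0 < m) {F F' : ℝ → ℝ}
    (hF : ∀ k ∈ Icc κ k₂, HasDerivAt F (F' k) k) (hF' : ContinuousOn F' (Icc κ k₂))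
    (hpos : ∀ k ∈ Ico κ k₂, 0 < F k) (hz : F k₂ = 0) :
    ∃ k Z : ℝ → ℝ, (∀ s, k s ∈ Ioo κ k₂) ∧ (∀ s, 0 < Z s) ∧ (∀ s, Z s < F (k s)) ∧
      (∀ s, HasDerivAt k (Z s - F (k s)) s) ∧ (∀ s, HasDerivAt Z (m * (k s - κ) * Z s) s) ∧
      Tendsto k atBot (𝓝 k₂) ∧ Tendsto Z atTop (𝓝 (F κ)) := by
  obtain ⟨D, C, hC, hDc, hDκ, hD⟩ := exists_phase_profile hk hm hF hF' hpos hz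
  obtain ⟨k, hkI, hkd, hktop, hkbot⟩ := exists_global_flow hk hC
    (hDc.mono Ioo_subset_Icc_self) (fun x hx => (hD x hx).1) (fun x hx => (hD x hx).2.2.1)
    (fun x hx => (hD x hx).2.2.2.1)
  refine ⟨k, fun s => F (k s) - D (k s), hkI, fun s => ?_, fun s => ?_, fun s => ?_, fun s => ?_,
    hkbot, ?_⟩
  · exact sub_pos.2 (hD _ (hkI s)).2.1
  · exact sub_lt_self _ (hD _ (hkI s)).1
  · simpa using hkd s
  · obtain ⟨h1, -, -, -, h2⟩ := hD _ (hkI s)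
    refine (((hF _ (Ioo_subset_Icc_self (hkI s))).comp s (hkd s)).sub
      (h2.comp s (hkd s))).congr_deriv ?_
    field_simp
    ring
  · have h1 : Tendsto k atTop (𝓝[Icc κ k₂] κ) := tendsto_nhdsWithin_iff.2
      ⟨hktop, Eventually.of_forall fun s => Ioo_subset_Icc_self (hkI s)⟩
    have h2 : Tendsto (fun x => F x - D x) (𝓝[Icc κ k₂] κ) (𝓝 (F κ - D κ)) :=
      ((hF κ (left_mem_Icc.2 hk.le)).continuousAt.continuousWithinAt.sub
        (hDc κ (left_mem_Icc.2 hk.le)))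
    rw [hDκ, sub_zero] at h2
    exact h2.comp h1

end Inversion

section BackwardAsymptotics

open Set

lemma monotoneOn_Iic_of_hasDerivAt {H H' : ℝ → ℝ} {s₀ : ℝ}
    (hH : ∀ s ≤ s₀, HasDerivAt H (H' s) s) (h0 : ∀ s ≤ s₀, 0 ≤ H' s) :
    MonotoneOn H (Iic s₀) := by
  refine monotoneOn_of_deriv_nonneg (convex_Iic s₀)
    (fun s hs => (hH s hs).continuousAt.continuousWithinAt)
    (fun s hs => (hH s (mem_Iic.1 (interior_subset hs))).differentiableAt.differentiableWithinAt)
    fun s hs => ?_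
  have hs' : s ≤ s₀ := mem_Iic.1 (interior_subset hs)
  rw [(hH s hs').deriv]
  exact h0 s hs'

lemma exists_tendsto_atBot_of_monotoneOn {W : ℝ → ℝ} {s₀ c : ℝ} (hW : MonotoneOn W (Iic s₀))
    (hc : ∀ s ≤ s₀, c ≤ W s) : ∃ l, Tendsto W atBot (𝓝 l) := by
  have hmono : Monotone fun s => W (min s s₀) := fun x y hxy =>
    hW (mem_Iic.2 (min_le_right _ _)) (mem_Iic.2 (min_le_right _ _)) (min_le_min_right _ hxy)
  refine ⟨_, (tendsto_atBot_ciInf hmono ⟨c, ?_⟩).congr' ?_⟩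
  · rintro _ ⟨s, rfl⟩
    exact hc _ (min_le_right _ _)
  · filter_upwards [eventually_le_atBot s₀] with s hs
    rw [min_eq_left hs]

/-- A function whose derivative is dominated by that of a function bounded below converges at
`-∞`. -/
lemma exists_tendsto_atBot_of_abs_deriv_le {H H' W W' : ℝ → ℝ} {s₀ : ℝ}
    (hH : ∀ s ≤ s₀, HasDerivAt H (H' s) s) (hW : ∀ s ≤ s₀, HasDerivAt W (W' s) s)
    (hle : ∀ s ≤ s₀, |H' s| ≤ W' s) (hbdd : ∀ s ≤ s₀, 0 ≤ W s) :
    ∃ l, Tendsto H atBot (𝓝 l) := by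
  have h1 : MonotoneOn W (Iic s₀) :=
    monotoneOn_Iic_of_hasDerivAt hW fun s hs => (abs_nonneg _).trans (hle s hs)
  have h2 : MonotoneOn (fun s => W s + H s) (Iic s₀) :=
    monotoneOn_Iic_of_hasDerivAt (fun s hs => (hW s hs).add (hH s hs)) fun s hs => by
      linarith [neg_abs_le (H' s), hle s hs]
  have h3 : MonotoneOn (fun s => W s - H s) (Iic s₀) :=
    monotoneOn_Iic_of_hasDerivAt (fun s hs => (hW s hs).sub (hH s hs)) fun s hs => by
      linarith [le_abs_self (H' s), hle s hs]
  obtain ⟨l, hl⟩ := exists_tendsto_atBot_of_monotoneOn h1 hbdd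
  obtain ⟨l', hl'⟩ := exists_tendsto_atBot_of_monotoneOn (c := H s₀ - W s₀) h2 fun s hs => by
    have := h3 hs (self_mem_Iic) hs
    simp only at this
    linarith [hbdd s hs]
  exact ⟨l' - l, (hl'.sub hl).congr fun s => by ring⟩

/-- Convergence of `L` when `L' = -y` and `y` decays exponentially at `-∞`. -/
lemma exists_tendsto_of_linear_decay {y f Z Z' L : ℝ → ℝ} {a μ : ℝ} (ha : 0 < a) (hμ : 0 < μ)
    (hypos : ∀ s, 0 < y s) (hZpos : ∀ s, 0 < Z s) (hy : ∀ s, HasDerivAt y (f s - Z s) s)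
    (hZ : ∀ s, HasDerivAt Z (Z' s) s) (hL : ∀ s, HasDerivAt L (-y s) s)
    (hZ' : ∀ᶠ s in atBot, μ * Z s ≤ Z' s) (hf : ∀ᶠ s in atBot, a * y s ≤ f s) :
    ∃ l, Tendsto L atBot (𝓝 l) := by
  obtain ⟨s₀, hs₀⟩ := eventually_atBot.1 (hZ'.and hf)
  refine exists_tendsto_atBot_of_abs_deriv_le (s₀ := s₀) (W := fun s => (y s + Z s / μ) / a)
    (fun s _ => hL s) (fun s _ => ((hy s).add ((hZ s).div_const μ)).div_const a) ?_ ?_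
  · intro s hs
    obtain ⟨h1, h2⟩ := hs₀ s hs
    rw [abs_neg, abs_of_pos (hypos s), le_div_iff₀ ha]
    have h3 : Z s ≤ Z' s / μ := by rwa [le_div_iff₀ hμ, mul_comm]
    linarith
  · intro s _
    have := hypos s
    have := hZpos s
    positivity

lemma tendsto_zero_of_exponential_decay {Q Q' : ℝ → ℝ} {s₀ ν : ℝ} (hν : 0 < ν)
    (hQ : ∀ s ≤ s₀, HasDerivAt Q (Q' s) s) (hQ' : ∀ s ≤ s₀, ν * Q s ≤ Q' s)
    (hpos : ∀ s ≤ s₀, 0 ≤ Q s) : Tendsto Q atBot (𝓝 0) := by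
  have hexp : ∀ s, HasDerivAt (fun s => Real.exp (-(ν * s))) (Real.exp (-(ν * s)) * -ν) s :=
    fun s => by simpa using (((hasDerivAt_id s).const_mul ν).neg).exp
  have hmono : MonotoneOn (fun s => Q s * Real.exp (-(ν * s))) (Iic s₀) :=
    monotoneOn_Iic_of_hasDerivAt (fun s hs => (hQ s hs).mul (hexp s)) fun s hs => by
      have := mul_le_mul_of_nonneg_right (hQ' s hs) (Real.exp_pos (-(ν * s))).le
      nlinarith
  have hlim : Tendsto (fun s => Q s₀ * Real.exp (-(ν * s₀)) * Real.exp (ν * s)) atBot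
      (𝓝 (Q s₀ * Real.exp (-(ν * s₀)) * 0)) :=
    (Real.tendsto_exp_atBot.comp (tendsto_id.const_mul_atBot hν)).const_mul _
  rw [mul_zero] at hlim
  refine squeeze_zero' ?_ ?_ hlim
  · filter_upwards [eventually_le_atBot s₀] with s hs using hpos s hs
  · filter_upwards [eventually_le_atBot s₀] with s hs
    have h1 := hmono hs self_mem_Iic hs
    simp only at h1
    have h2 : Q s = Q s * Real.exp (-(ν * s)) * Real.exp (ν * s) := by
      rw [mul_assoc, ← Real.exp_add, neg_add_cancel, Real.exp_zero, mul_one]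
    rw [h2]
    exact mul_le_mul_of_nonneg_right h1 (Real.exp_pos _).le

/-- If the derivative tends to `-c` at `-∞`, then `X(s) / (-s)` tends to `c`. -/
lemma tendsto_div_neg_of_deriv {X X' : ℝ → ℝ} {c : ℝ} (hX : ∀ s, HasDerivAt X (X' s) s)
    (hX' : Tendsto X' atBot (𝓝 (-c))) : Tendsto (fun s => X s / -s) atBot (𝓝 c) := by
  rw [Metric.tendsto_nhds]
  intro ε hε
  obtain ⟨s₁, hs₁⟩ := eventually_atBot.1 ((Metric.tendsto_nhds.1 hX') (ε / 2) (half_pos hε))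
  have hG : ∀ s, HasDerivAt (fun s => X s + c * s) (X' s + c) s := fun s =>
    ((hX s).add ((hasDerivAt_id s).const_mul c)).congr_deriv (by simp)
  set K := |X s₁ + c * s₁| + ε / 2 * |s₁| with hK
  have hbig : ∀ᶠ s : ℝ in atBot, K < ε / 2 * (-s) :=
    (tendsto_neg_atBot_atTop.const_mul_atTop (half_pos hε)).eventually_gt_atTop K
  filter_upwards [hbig, eventually_le_atBot s₁, eventually_lt_atBot 0] with s hs1 hs2 hs3
  have hmv := (convex_Iic s₁).norm_image_sub_le_of_norm_hasDerivWithin_le (C := ε / 2)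
    (fun t _ => (hG t).hasDerivWithinAt) (fun t ht => ?_) (self_mem_Iic) hs2
  · have hs : (0 : ℝ) < -s := by linarith
    have h1 : X s / -s - c = (X s + c * s) / -s := by
      have : s ≠ 0 := hs3.ne
      field_simp
      ring
    rw [Real.dist_eq, h1, abs_div, abs_of_pos hs, div_lt_iff₀ hs]
    rw [Real.norm_eq_abs, Real.norm_eq_abs, abs_of_nonpos (sub_nonpos.2 hs2)] at hmv
    have h2 : |X s + c * s| ≤ |X s + c * s - (X s₁ + c * s₁)| + |X s₁ + c * s₁| := by
      simpa using abs_add_le (X s + c * s - (X s₁ + c * s₁)) (X s₁ + c * s₁)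
    nlinarith [le_abs_self s₁]
  · have := (hs₁ t ht).le
    rwa [Real.dist_eq, sub_neg_eq_add] at this

/-- Logarithmic correction to `L` when `L' = -y` and `y' ≈ c y²` at `-∞`. -/
lemma exists_tendsto_of_quadratic_decay {y f Z Z' L : ℝ → ℝ} {c C μ : ℝ} (hc : 0 < c)
    (hC : 0 ≤ C) (hμ : 0 < μ)
    (hypos : ∀ s, 0 < y s) (hZpos : ∀ s, 0 < Z s) (hy : ∀ s, HasDerivAt y (f s - Z s) s)
    (hZ : ∀ s, HasDerivAt Z (Z' s) s) (hL : ∀ s, HasDerivAt L (-y s) s)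
    (hylim : Tendsto y atBot (𝓝 0))
    (hZ' : ∀ᶠ s in atBot, μ * Z s ≤ Z' s)
    (hf : ∀ᶠ s in atBot, |f s - c * y s ^ 2| ≤ C * y s ^ 3) :
    ∃ l, Tendsto (fun s => L s - 1 / c * Real.log (-s)) atBot (𝓝 l) := by
  have hCy : Tendsto (fun s => C * y s) atBot (𝓝 0) := by simpa using hylim.const_mul C
  have hcy : Tendsto (fun s => 3 * c * y s) atBot (𝓝 0) := by simpa using hylim.const_mul (3 * c)
  obtain ⟨s₀, hs₀⟩ := eventually_atBot.1 ((hZ'.and hf).and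
    ((hCy.eventually (ge_mem_nhds (half_pos hc))).and
      (hcy.eventually (ge_mem_nhds (half_pos hμ)))))
  have hylow : ∀ s ≤ s₀, c / 2 * y s ^ 2 ≤ f s := fun s hs => by
    obtain ⟨⟨-, h1⟩, h2, -⟩ := hs₀ s hs
    nlinarith [(abs_le.1 h1).1, mul_le_mul_of_nonneg_right h2 (sq_nonneg (y s))]
  have hyup : ∀ s ≤ s₀, 2 * f s ≤ 3 * c * y s ^ 2 := fun s hs => by
    obtain ⟨⟨-, h1⟩, h2, -⟩ := hs₀ s hs
    nlinarith [(abs_le.1 h1).2, mul_le_mul_of_nonneg_right h2 (sq_nonneg (y s))]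
  have hrate : ∀ s ≤ s₀, 2 * f s ≤ μ / 2 * y s := fun s hs => by
    obtain ⟨-, -, h3⟩ := hs₀ s hs
    nlinarith [hyup s hs, mul_le_mul_of_nonneg_right h3 (hypos s).le]
  -- the ratio `Z / y ^ 2` decays exponentially
  have hQd : ∀ s, HasDerivAt (fun s => Z s / y s ^ 2)
      ((Z' s * y s ^ 2 - Z s * (2 * y s * (f s - Z s))) / (y s ^ 2) ^ 2) s := fun s => by
    have h1 : HasDerivAt (fun s => y s ^ 2) (2 * y s * (f s - Z s)) s := by
      simpa using (hy s).fun_pow 2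
    exact (hZ s).div h1 (pow_pos (hypos s) 2).ne'
  have hQ : Tendsto (fun s => Z s / y s ^ 2) atBot (𝓝 0) := by
    refine tendsto_zero_of_exponential_decay (s₀ := s₀) (half_pos hμ) (fun s _ => hQd s) ?_ ?_
    · intro s hs
      have h1 := hypos s
      have h2 := hZpos s
      have h3 := hrate s hs
      obtain ⟨⟨h4, -⟩, -⟩ := hs₀ s hs
      have h5 : μ / 2 * (Z s / y s ^ 2) = (μ / 2 * Z s * y s ^ 2) / (y s ^ 2) ^ 2 := by
        field_simp
      rw [h5]
      refine div_le_div_of_nonneg_right ?_ (by positivity)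
      have h6 := mul_le_mul_of_nonneg_right h4 (sq_nonneg (y s))
      have h7 := mul_le_mul_of_nonneg_right h3 (mul_pos h2 h1).le
      nlinarith [mul_pos h1 (mul_pos h2 h2)]
    · intro s _
      have := hypos s
      have := hZpos s
      positivity
  have hX : Tendsto (fun s => (y s)⁻¹ / -s) atBot (𝓝 c) := by
    refine tendsto_div_neg_of_deriv (X := fun s => (y s)⁻¹) (fun s => (hy s).inv (hypos s).ne') ?_
    have h1 : Tendsto (fun s => f s / y s ^ 2 - c) atBot (𝓝 0) := by
      refine squeeze_zero_norm' ?_ hCy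
      filter_upwards [hf] with s hs
      have h2 := hypos s
      have h3 : f s / y s ^ 2 - c = (f s - c * y s ^ 2) / y s ^ 2 := by field_simp
      rw [h3, Real.norm_eq_abs, abs_div, abs_of_pos (by positivity : 0 < y s ^ 2),
        div_le_iff₀ (by positivity)]
      linarith
    have h4 : Tendsto (fun s => -(f s / y s ^ 2 - c) + Z s / y s ^ 2 + -c) atBot
        (𝓝 (-0 + 0 + -c)) := ((h1.neg).add hQ).add_const _
    rw [neg_zero, zero_add, zero_add] at h4
    refine h4.congr fun s => ?_
    have := hypos s
    field_simp
    ring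
  -- the corrected logarithm converges
  have hRd : ∀ s, HasDerivAt (fun s => Z s / y s)
      ((Z' s * y s - Z s * (f s - Z s)) / y s ^ 2) s := fun s => (hZ s).div (hy s) (hypos s).ne'
  have hconv : ∃ l, Tendsto (fun s => L s + 1 / c * Real.log (y s)) atBot (𝓝 l) := by
    refine exists_tendsto_atBot_of_abs_deriv_le (s₀ := s₀)
      (W := fun s => 2 * C / c ^ 2 * (y s + Z s / μ) + 1 / c * (2 / μ * (Z s / y s)))
      (fun s _ => (hL s).add (((hy s).log (hypos s).ne').const_mul _))
      (fun s _ => (((hy s).add ((hZ s).div_const μ)).const_mul _).add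
        (((hRd s).const_mul _).const_mul _)) ?_ ?_
    · intro s hs
      have h1 := hypos s
      have h2 := hZpos s
      obtain ⟨⟨h4, h5⟩, -⟩ := hs₀ s hs
      have h3 := hrate s hs
      have h6 : -y s + 1 / c * ((f s - Z s) / y s) =
          (f s - c * y s ^ 2) / (c * y s) - Z s / (c * y s) := by
        field_simp
        ring
      rw [h6]
      refine (abs_sub _ _).trans (add_le_add ?_ ?_)
      · rw [abs_div, abs_of_pos (by positivity : 0 < c * y s), div_le_iff₀ (by positivity)]
        refine h5.trans ?_
        have h7 : Z s ≤ Z' s / μ := by rwa [le_div_iff₀ hμ, mul_comm]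
        have h8 : c / 2 * y s ^ 2 ≤ f s - Z s + Z' s / μ := by linarith [hylow s hs]
        calc C * y s ^ 3 = 2 * C / c ^ 2 * (c / 2 * y s ^ 2) * (c * y s) := by field_simp
          _ ≤ _ := by gcongr
      · rw [abs_of_pos (by positivity)]
        have h7 : Z s / (c * y s) = 1 / c * (2 / μ * ((μ / 2 * Z s * y s) / y s ^ 2)) := by
          field_simp
        rw [h7]
        gcongr
        nlinarith [mul_le_mul_of_nonneg_right h4 h1.le, mul_le_mul_of_nonneg_right h3 h2.le,
          mul_pos h1 h2]
    · intro s _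
      have := hypos s
      have := hZpos s
      positivity
  obtain ⟨l, hl⟩ := hconv
  have h1 := (Real.continuousAt_log hc.ne').tendsto.comp hX
  refine ⟨l + 1 / c * Real.log c, (hl.add (h1.const_mul (1 / c))).congr' ?_⟩
  filter_upwards [eventually_lt_atBot 0] with s hs
  simp only [Function.comp_apply]
  rw [Real.log_div (inv_pos.2 (hypos s)).ne' (by linarith), Real.log_inv]
  ring

end BackwardAsymptotics

section PhaseFunction

open Set

/-- The values `f_ρ(-k)` for `k > 0`. -/
def phaseFun (ρ lam τ k : ℝ) : ℝ := k ^ 2 - 2 * ρ * k + lam * k ^ (1 - τ)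

/-- The derivative of `phaseFun`. -/
def phaseFunDeriv (ρ lam τ k : ℝ) : ℝ := 2 * k - 2 * ρ + lam * (1 - τ) * k ^ (-τ)

variable {ρ lam τ k w : ℝ}

lemma fRho_neg_eq_phaseFun (hk : 0 < k) : fRho ρ lam τ (-k) = phaseFun ρ lam τ k := by
  rw [fRho, phaseFun, abs_neg, abs_of_pos hk]
  ring

lemma hasDerivAt_phaseFun (hk : 0 < k) :
    HasDerivAt (phaseFun ρ lam τ) (phaseFunDeriv ρ lam τ k) k := by
  have h1 := (Real.hasDerivAt_rpow_const (p := 1 - τ) (Or.inl hk.ne')).const_mul lam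
  have h2 := (hasDerivAt_id k).fun_pow 2
  refine ((h2.sub ((hasDerivAt_id k).const_mul (2 * ρ))).add h1).congr_deriv ?_
  rw [phaseFunDeriv, show 1 - τ - 1 = -τ by ring]
  simp
  ring

lemma hasDerivAt_phaseFunDeriv (hk : 0 < k) :
    HasDerivAt (phaseFunDeriv ρ lam τ) (2 - lam * τ * (1 - τ) * k ^ (-τ - 1)) k := by
  have h1 := (Real.hasDerivAt_rpow_const (p := -τ) (Or.inl hk.ne')).const_mul (lam * (1 - τ))
  refine ((((hasDerivAt_id k).const_mul 2).sub_const (2 * ρ)).add h1).congr_deriv ?_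
  ring

lemma phaseFun_eq_mul (hk : 0 < k) :
    phaseFun ρ lam τ k = k * (k - 2 * ρ + lam * k ^ (-τ)) := by
  rw [phaseFun, show 1 - τ = 1 + -τ by ring, Real.rpow_add hk, Real.rpow_one]
  ring

/-- `phaseFun` is positive before the point corresponding to the largest negative root. -/
lemma phaseFun_pos (hlam : 0 < lam) (hτ0 : 0 < τ) (hτ1 : τ < 1) (hw : IsMaxNegRoot ρ lam τ w)
    (hk : 0 < k) (hkw : k < -w) : 0 < phaseFun ρ lam τ k := by
  by_contra! hneg
  have hcont : Continuous fun x : ℝ => x ^ (1 + τ) - 2 * ρ * x ^ τ + lam :=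
    ((Real.continuous_rpow_const (by linarith)).sub
      ((Real.continuous_rpow_const hτ0.le).const_mul _)).add_const _
  have h0 : Tendsto (fun x : ℝ => x ^ (1 + τ) - 2 * ρ * x ^ τ + lam) (𝓝[>] 0) (𝓝 lam) := by
    have := hcont.tendsto 0
    rw [Real.zero_rpow (by linarith), Real.zero_rpow hτ0.ne'] at this
    simpa using this.mono_left nhdsWithin_le_nhds
  obtain ⟨x, hx1, hx2⟩ := ((h0.eventually (lt_mem_nhds hlam)).and (Ioo_mem_nhdsGT hk)).exists
  have hx : phaseFun ρ lam τ x = x ^ (1 - τ) * (x ^ (1 + τ) - 2 * ρ * x ^ τ + lam) := by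
    have e1 : x ^ (1 - τ) * x ^ (1 + τ) = x ^ 2 := by
      rw [← Real.rpow_add hx2.1, show 1 - τ + (1 + τ) = (2 : ℕ) by push_cast; ring,
        Real.rpow_natCast]
    have e2 : x ^ (1 - τ) * x ^ τ = x := by
      rw [← Real.rpow_add hx2.1, sub_add_cancel, Real.rpow_one]
    rw [phaseFun, mul_add, mul_sub, e1, mul_left_comm, e2]
    ring
  have hxpos : 0 < phaseFun ρ lam τ x := by
    rw [hx]
    exact mul_pos (Real.rpow_pos_of_pos hx2.1 _) hx1
  have hc : ContinuousOn (phaseFun ρ lam τ) (Icc x k) := fun y hy =>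
    (hasDerivAt_phaseFun (hx2.1.trans_le hy.1)).continuousAt.continuousWithinAt
  obtain ⟨z, hz, hz0⟩ := intermediate_value_Icc' hx2.2.le hc ⟨hneg, hxpos.le⟩
  have hzpos : 0 < z := hx2.1.trans_le hz.1
  have := hw.2.2 (-z) (by linarith) (by rw [fRho_neg_eq_phaseFun hzpos, hz0])
  linarith [hz.2]

lemma phaseFun_root (hw : IsMaxNegRoot ρ lam τ w) : phaseFun ρ lam τ (-w) = 0 := by
  rw [← fRho_neg_eq_phaseFun (by linarith [hw.1]), neg_neg, hw.2.1]

/-- The slope of `phaseFun` at its first root is negative off the critical value of `ρ`. -/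
lemma phaseFunDeriv_neg (hlam : 0 < lam) (hτ0 : 0 < τ) (hτ1 : τ < 1)
    (hw : IsMaxNegRoot ρ lam τ w) (hρ : ρ ≠ Upsilon lam τ) : phaseFunDeriv ρ lam τ (-w) < 0 := by
  have hk : 0 < -w := by linarith [hw.1]
  have hd := hasDerivAt_phaseFun (ρ := ρ) (lam := lam) (τ := τ) hk
  have hroot := phaseFun_root hw
  refine lt_of_le_of_ne ?_ fun h0 => hρ ?_
  · have hsl : Tendsto (slope (phaseFun ρ lam τ) (-w)) (𝓝[<] (-w))
        (𝓝 (phaseFunDeriv ρ lam τ (-w))) :=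
      (hasDerivAt_iff_tendsto_slope.1 hd).mono_left (nhdsWithin_mono _ fun z hz => ne_of_lt hz)
    refine le_of_tendsto hsl ?_
    filter_upwards [Ioo_mem_nhdsLT hk] with z hz
    rw [slope_def_field, hroot, sub_zero]
    exact div_nonpos_of_nonneg_of_nonpos (phaseFun_pos hlam hτ0 hτ1 hw hz.1 hz.2).le
      (by linarith [hz.2])
  · rw [phaseFun_eq_mul hk] at hroot
    have h1 := (mul_eq_zero.1 hroot).resolve_left hk.ne'
    rw [phaseFunDeriv] at h0
    have h2 : -w = lam * τ * (-w) ^ (-τ) := by linarith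
    have h3 : (-w) ^ (τ + 1) = lam * τ := by
      have e : (-w) ^ (-τ) * (-w) ^ τ = 1 := by
        rw [← Real.rpow_add hk, neg_add_cancel, Real.rpow_zero]
      rw [Real.rpow_add hk, Real.rpow_one]
      nth_rewrite 2 [h2]
      linear_combination lam * τ * e
    have h4 : (lam * τ) ^ (1 / (τ + 1)) = -w := by
      rw [← h3, ← Real.rpow_mul hk.le, mul_one_div_cancel (by linarith), Real.rpow_one]
    rw [Upsilon, h4]
    field_simp
    linear_combination (-τ) * h1 - h2

/-- At the critical value of `ρ` the first root is `(λτ)^(1/(τ+1))`. -/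
lemma critical_root (hlam : 0 < lam) (hτ0 : 0 < τ)
    (hw : IsMaxNegRoot ρ lam τ w) (hρ : ρ = Upsilon lam τ) : (-w) ^ (-τ - 1) = (lam * τ)⁻¹ := by
  have hlt : 0 < lam * τ := mul_pos hlam hτ0
  set K := (lam * τ) ^ (1 / (τ + 1)) with hK
  have hKpos : 0 < K := Real.rpow_pos_of_pos hlt _
  have hKpow : K ^ (-τ - 1) = (lam * τ)⁻¹ := by
    rw [hK, ← Real.rpow_mul hlt.le, show 1 / (τ + 1) * (-τ - 1) = -1 by field_simp; ring,
      Real.rpow_neg_one]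
  have hKτ : lam * K ^ (-τ) = K / τ := by
    rw [show -τ = -τ - 1 + 1 by ring, Real.rpow_add hKpos, Real.rpow_one, hKpow]
    field_simp
  have hKroot : K - 2 * ρ + lam * K ^ (-τ) = 0 := by
    rw [hKτ, hρ, Upsilon, ← hK]
    field_simp
    ring
  have hk : 0 < -w := by linarith [hw.1]
  have hle : -w ≤ K := by
    have := hw.2.2 (-K) (by linarith)
      (by rw [fRho_neg_eq_phaseFun hKpos, phaseFun_eq_mul hKpos, hKroot, mul_zero])
    linarith
  rcases hle.eq_or_lt with h | h
  · rw [h, hKpow]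
  · exfalso
    have hd : ∀ x, 0 < x → HasDerivAt (fun x => x - 2 * ρ + lam * x ^ (-τ))
        (1 - lam * τ * x ^ (-τ - 1)) x := fun x hx => by
      have h1 := (Real.hasDerivAt_rpow_const (p := -τ) (Or.inl hx.ne')).const_mul lam
      refine (((hasDerivAt_id x).sub_const (2 * ρ)).add h1).congr_deriv ?_
      ring
    have hanti : StrictAntiOn (fun x => x - 2 * ρ + lam * x ^ (-τ)) (Icc (-w) K) := by
      refine strictAntiOn_of_deriv_neg (convex_Icc _ _) (fun x hx =>
        (hd x (hk.trans_le hx.1)).continuousAt.continuousWithinAt) fun x hx => ?_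
      rw [interior_Icc] at hx
      have hx0 := hk.trans hx.1
      rw [(hd x hx0).deriv]
      have h1 : K ^ (-τ - 1) < x ^ (-τ - 1) :=
        Real.rpow_lt_rpow_of_neg hx0 hx.2 (by linarith)
      rw [hKpow] at h1
      have h2 := mul_lt_mul_of_pos_left h1 hlt
      rw [mul_inv_cancel₀ hlt.ne'] at h2
      linarith
    have h1 := hanti (left_mem_Icc.2 hle) (right_mem_Icc.2 hle) h
    have h2 := phaseFun_root hw
    rw [phaseFun_eq_mul hk] at h2
    have h3 := (mul_eq_zero.1 h2).resolve_left hk.ne'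
    simp only [h3, hKroot, lt_irrefl] at h1

lemma abs_le_pow_succ_of_abs_deriv_le {g g' : ℝ → ℝ} {a b C : ℝ} {n : ℕ} (hC : 0 ≤ C)
    (hg : ∀ x ∈ Icc a b, HasDerivAt g (g' x) x) (hb : g b = 0)
    (hbound : ∀ x ∈ Icc a b, |g' x| ≤ C * (b - x) ^ n) :
    ∀ x ∈ Icc a b, |g x| ≤ C * (b - x) ^ (n + 1) := by
  intro x hx
  have hsub : Icc x b ⊆ Icc a b := Icc_subset_Icc_left hx.1
  have hmv := (convex_Icc x b).norm_image_sub_le_of_norm_hasDerivWithin_le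
    (C := C * (b - x) ^ n) (fun y hy => (hg y (hsub hy)).hasDerivWithinAt)
    (fun y hy => (hbound y (hsub hy)).trans ?_) (right_mem_Icc.2 hx.2) (left_mem_Icc.2 hx.2)
  · rw [hb, sub_zero, Real.norm_eq_abs, Real.norm_eq_abs, abs_sub_comm,
      abs_of_nonneg (sub_nonneg.2 hx.2)] at hmv
    rwa [pow_succ, ← mul_assoc]
  · have h1 : 0 ≤ b - y := sub_nonneg.2 hy.2
    have h2 : b - y ≤ b - x := by linarith [hy.1]
    gcongr

/-- Quadratic behaviour of `phaseFun` at its first root in the critical case. -/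
lemma phaseFun_quadratic (hlam : 0 < lam) (hτ0 : 0 < τ)
    (hw : IsMaxNegRoot ρ lam τ w) (hρ : ρ = Upsilon lam τ) :
    ∃ C, 0 ≤ C ∧ ∀ k ∈ Icc (-w / 2) (-w),
      |phaseFun ρ lam τ k - (1 + τ) / 2 * (-w - k) ^ 2| ≤ C * (-w - k) ^ 3 := by
  have hk : 0 < -w := by linarith [hw.1]
  have hlt : 0 < lam * τ := mul_pos hlam hτ0
  have hpos : ∀ x ∈ Icc (-w / 2) (-w), 0 < x := fun x hx => (half_pos hk).trans_le hx.1
  have hpow := critical_root hlam hτ0 hw hρ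
  have hroot := phaseFun_root hw
  have hKτ : lam * τ * (-w) ^ (-τ) = -w := by
    rw [show -τ = -τ - 1 + 1 by ring, Real.rpow_add hk, Real.rpow_one, hpow,
      mul_inv_cancel_left₀ hlt.ne']
  have hslope : phaseFunDeriv ρ lam τ (-w) = 0 := by
    rw [phaseFun_eq_mul hk] at hroot
    have h3 := (mul_eq_zero.1 hroot).resolve_left hk.ne'
    rw [phaseFunDeriv]
    linear_combination h3 - hKτ
  have hd3 : ∀ x ∈ Icc (-w / 2) (-w),
      HasDerivAt (fun x => 2 - lam * τ * (1 - τ) * x ^ (-τ - 1) - (1 + τ))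
        (-(lam * τ * (1 - τ) * ((-τ - 1) * x ^ (-τ - 1 - 1)))) x := fun x hx =>
    ((((Real.hasDerivAt_rpow_const (Or.inl (hpos x hx).ne')).const_mul _).const_sub _).sub_const _)
  have hcont : ContinuousOn (fun x : ℝ => -(lam * τ * (1 - τ) * ((-τ - 1) * x ^ (-τ - 1 - 1))))
      (Icc (-w / 2) (-w)) := by
    refine ContinuousOn.neg (continuousOn_const.mul (continuousOn_const.mul ?_))
    exact continuousOn_id.rpow_const fun x hx => Or.inl (hpos x hx).ne'
  obtain ⟨C, hC⟩ := isCompact_Icc.exists_bound_of_continuousOn hcont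
  have hC0 : 0 ≤ C := (norm_nonneg _).trans (hC (-w) ⟨by linarith, le_rfl⟩)
  have h2 := abs_le_pow_succ_of_abs_deriv_le hC0 (n := 0) hd3
    (by simp only [hpow]; field_simp; ring) (fun x hx => by simpa using hC x hx)
  have h1 := abs_le_pow_succ_of_abs_deriv_le hC0
    (g := fun x => phaseFunDeriv ρ lam τ x + (1 + τ) * (-w - x)) (fun x hx =>
      ((hasDerivAt_phaseFunDeriv (hpos x hx)).add
        (((hasDerivAt_id x).const_sub (-w)).const_mul (1 + τ))).congr_deriv (by ring))
    (by simp [hslope]) h2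
  refine ⟨C, hC0, abs_le_pow_succ_of_abs_deriv_le hC0
    (g := fun x => phaseFun ρ lam τ x - (1 + τ) / 2 * (-w - x) ^ 2) (fun x hx =>
      ((hasDerivAt_phaseFun (hpos x hx)).sub
        ((((hasDerivAt_id x).const_sub (-w)).fun_pow 2).const_mul ((1 + τ) / 2))).congr_deriv
          (by simp; ring)) (by simp [hroot]) h1⟩

end PhaseFunction

section RadialProfile

open Set

variable {ρ lam τ θ q w : ℝ}

/-- The exponent of `|log r|` in `Φ_{ϖ₂}`. -/
def logExponent (ρ lam τ : ℝ) : ℝ := if ρ = Upsilon lam τ then 2 / (1 + τ) else 0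

lemma Phi2_eq_exp {r : ℝ} (hr0 : 0 < r) (hr1 : r < 1) :
    Phi2 ρ lam τ w r =
      Real.exp (-w * Real.log r + logExponent ρ lam τ * Real.log (-Real.log r)) := by
  have hlog : 0 < -Real.log r := neg_pos.2 (Real.log_neg hr0 hr1)
  rw [Phi2, logExponent, Real.exp_add, mul_comm (-w), ← Real.rpow_def_of_pos hr0]
  split_ifs with h
  · rw [mul_comm (2 / (1 + τ)), ← Real.rpow_def_of_pos hlog, ← abs_neg, abs_of_pos hlog]
  · simp

lemma tendsto_log_neg_sub_sub_log_neg (a : ℝ) :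
    Tendsto (fun s => Real.log (-(s - a)) - Real.log (-s)) atBot (𝓝 0) := by
  have h1 : Tendsto (fun s : ℝ => a * s⁻¹) atBot (𝓝 (a * 0)) :=
    tendsto_inv_atBot_zero.const_mul a
  have h2 : Tendsto (fun s : ℝ => 1 - a * s⁻¹) atBot (𝓝 1) := by
    simpa using h1.const_sub 1
  have h3 := (Real.continuousAt_log one_ne_zero).tendsto.comp h2
  rw [Real.log_one] at h3
  refine h3.congr' ?_
  filter_upwards [eventually_lt_atBot 0, eventually_lt_atBot a] with s hs hsa
  rw [← Real.log_div (by linarith) (by linarith), Function.comp_apply]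
  congr 1
  have := hs.ne
  field_simp

/-- Behaviour at `-∞` along the heteroclinic orbit leaving `(-w, 0)`. -/
lemma exists_tendsto_phase_log (hlam : 0 < lam) (hτ0 : 0 < τ) (hτ1 : τ < 1)
    (hw : IsMaxNegRoot ρ lam τ w) {κ m : ℝ} (hm : 0 < m) (hκ : κ < -w) {k Z L : ℝ → ℝ}
    (hkI : ∀ s, k s < -w) (hZpos : ∀ s, 0 < Z s)
    (hk : ∀ s, HasDerivAt k (Z s - phaseFun ρ lam τ (k s)) s)
    (hZ : ∀ s, HasDerivAt Z (m * (k s - κ) * Z s) s) (hkbot : Tendsto k atBot (𝓝 (-w)))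
    (hL : ∀ s, HasDerivAt L (k s - -w) s) :
    ∃ l, Tendsto (fun s => L s - logExponent ρ lam τ * Real.log (-s)) atBot (𝓝 l) := by
  have hw0 : 0 < -w := by linarith [hw.1]
  have hypos : ∀ s, 0 < -w - k s := fun s => sub_pos.2 (hkI s)
  have hy : ∀ s, HasDerivAt (fun s => -w - k s) (phaseFun ρ lam τ (k s) - Z s) s := fun s =>
    ((hk s).const_sub (-w)).congr_deriv (by ring)
  have hL' : ∀ s, HasDerivAt L (-(-w - k s)) s := fun s => (hL s).congr_deriv (by ring)
  have hμ : 0 < m * ((-w - κ) / 2) := mul_pos hm (half_pos (sub_pos.2 hκ))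
  have hZ' : ∀ᶠ s in atBot, m * ((-w - κ) / 2) * Z s ≤ m * (k s - κ) * Z s := by
    have h1 : (-w + κ) / 2 < -w := by linarith
    filter_upwards [hkbot.eventually (lt_mem_nhds h1)] with s hs
    exact mul_le_mul_of_nonneg_right (mul_le_mul_of_nonneg_left (by linarith) hm.le)
      (hZpos s).le
  by_cases hρ : ρ = Upsilon lam τ
  · obtain ⟨C, hC0, hC⟩ := phaseFun_quadratic hlam hτ0 hw hρ
    have hylim : Tendsto (fun s => -w - k s) atBot (𝓝 0) := by
      simpa using hkbot.const_sub (-w)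
    have hf : ∀ᶠ s in atBot, |phaseFun ρ lam τ (k s) - (1 + τ) / 2 * (-w - k s) ^ 2| ≤
        C * (-w - k s) ^ 3 := by
      filter_upwards [hkbot.eventually (lt_mem_nhds (half_lt_self hw0))] with s hs
      exact hC _ ⟨hs.le, (hkI s).le⟩
    have := exists_tendsto_of_quadratic_decay (by linarith) hC0 hμ hypos hZpos hy hZ hL' hylim
      hZ' hf
    rwa [one_div_div, ← show logExponent ρ lam τ = 2 / (1 + τ) from if_pos hρ] at this
  · have hneg := phaseFunDeriv_neg hlam hτ0 hτ1 hw hρ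
    have hd := hasDerivAt_phaseFun (ρ := ρ) (lam := lam) (τ := τ) hw0
    have hne : Tendsto k atBot (𝓝[≠] (-w)) := tendsto_nhdsWithin_iff.2
      ⟨hkbot, Eventually.of_forall fun s => (hkI s).ne⟩
    have hf : ∀ᶠ s in atBot, -phaseFunDeriv ρ lam τ (-w) / 2 * (-w - k s) ≤
        phaseFun ρ lam τ (k s) := by
      have h1 : phaseFunDeriv ρ lam τ (-w) < phaseFunDeriv ρ lam τ (-w) / 2 := by linarith
      filter_upwards [((hasDerivAt_iff_tendsto_slope.1 hd).comp hne).eventually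
        (gt_mem_nhds h1)] with s hs
      rw [Function.comp_apply, slope_def_field, phaseFun_root hw, sub_zero,
        div_lt_iff_of_neg (by linarith [hkI s])] at hs
      linarith
    have := exists_tendsto_of_linear_decay (by linarith) hμ hypos hZpos hy hZ hL' hZ' hf
    rw [show logExponent ρ lam τ = 0 from if_neg hρ]
    simpa using this

/-- The radial profile of `u_b` in the variable `s = log r`. -/
lemma exists_log_profile (hlam : 0 < lam) (hτ0 : 0 < τ) (hτ1 : τ < 1)
    (hw : IsMaxNegRoot ρ lam τ w) {κ m : ℝ} (hm : 0 < m) (hκ0 : 0 < κ) (hκ : κ < -w) (B : ℝ) :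
    ∃ k Z V : ℝ → ℝ, (∀ s, 0 < k s) ∧ (∀ s, 0 < Z s) ∧ Continuous Z ∧
      (∀ s, HasDerivAt k (Z s - phaseFun ρ lam τ (k s)) s) ∧
      (∀ s, HasDerivAt V (k s * V s) s) ∧
      (∀ s, V s = Z s ^ (1 / m) * Real.exp (κ * s)) ∧
      Tendsto Z atTop (𝓝 (phaseFun ρ lam τ κ)) ∧
      Tendsto (fun s => Real.log (V s) + w * s - logExponent ρ lam τ * Real.log (-s)) atBot
        (𝓝 B) := by
  have hpos : ∀ x ∈ Icc κ (-w), 0 < x := fun x hx => hκ0.trans_le hx.1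
  obtain ⟨k, Z, hkI, hZpos, -, hk, hZ, hkbot, hZtop⟩ := exists_heteroclinic hκ hm
    (fun x hx => hasDerivAt_phaseFun (ρ := ρ) (lam := lam) (τ := τ) (hpos x hx))
    (fun x hx => (hasDerivAt_phaseFunDeriv (hpos x hx)).continuousAt.continuousWithinAt)
    (fun x hx => phaseFun_pos hlam hτ0 hτ1 hw (hκ0.trans_le hx.1) hx.2) (phaseFun_root hw)
  have hlogV : ∀ s, HasDerivAt (fun s => Real.log (Z s) / m + κ * s) (k s) s := fun s => by
    refine ((((hZ s).log (hZpos s).ne').div_const m).add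
      ((hasDerivAt_id s).const_mul κ)).congr_deriv ?_
    have := hZpos s
    field_simp
    ring
  obtain ⟨l, hl⟩ := exists_tendsto_phase_log hlam hτ0 hτ1 hw hm hκ (fun s => (hkI s).2) hZpos hk
    hZ hkbot (L := fun s => Real.log (Z s) / m + κ * s - -w * s) fun s =>
      ((hlogV s).sub ((hasDerivAt_id s).const_mul (-w))).congr_deriv (by ring)
  set a := (l - B) / (-w - κ) with ha
  have hshift : ∀ s, HasDerivAt (fun s => s - a) 1 s := fun s => (hasDerivAt_id s).sub_const a
  have hVd : ∀ s, HasDerivAt (fun s => Real.exp (Real.log (Z (s - a)) / m + κ * s))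
      (k (s - a) * Real.exp (Real.log (Z (s - a)) / m + κ * s)) s := fun s => by
    have h1 := ((hlogV (s - a)).comp s (hshift s)).add_const (κ * a)
    have h2 : (fun s => Real.log (Z (s - a)) / m + κ * s) =
        fun s => ((fun s => Real.log (Z s) / m + κ * s) ∘ fun s => s - a) s + κ * a := by
      funext t
      simp only [Function.comp_apply]
      ring
    rw [mul_one, ← h2] at h1
    exact h1.exp.congr_deriv (by ring)
  refine ⟨fun s => k (s - a), fun s => Z (s - a),
    fun s => Real.exp (Real.log (Z (s - a)) / m + κ * s), fun s => hκ0.trans (hkI _).1,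
    fun s => hZpos _, ?_, fun s => ?_, hVd, fun s => ?_, ?_, ?_⟩
  · exact (continuous_iff_continuousAt.2 fun s => (hZ s).continuousAt).comp
      (continuous_id.sub continuous_const)
  · exact ((hk (s - a)).comp s (hshift s)).congr_deriv (mul_one _)
  · beta_reduce
    rw [Real.exp_add, Real.rpow_def_of_pos (hZpos _), mul_one_div]
  · exact hZtop.comp (tendsto_atTop_add_const_right _ (-a) tendsto_id)
  · have h1 := hl.comp (tendsto_atBot_add_const_right _ (-a) tendsto_id)
    have h2 := (h1.add ((tendsto_log_neg_sub_sub_log_neg a).const_mul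
      (logExponent ρ lam τ))).add_const (-((-w - κ) * a))
    have h3 : l + logExponent ρ lam τ * 0 + -((-w - κ) * a) = B := by
      rw [ha, mul_div_cancel₀ _ (sub_pos.2 hκ).ne']
      ring
    rw [h3] at h2
    refine h2.congr fun s => ?_
    simp only [Function.comp_apply, id, Real.log_exp, ← sub_eq_add_neg]
    ring

end RadialProfile

section Assembly

open Set

variable {ρ lam τ θ q w : ℝ}

/-- A profile in the variable `log r` yields a radial solution of (E). -/
lemma isSolutionE_of_log_profile {N : ℕ} [NeZero N] (hτ1 : τ < 1) (hq : 1 < q)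
    {k Z V : ℝ → ℝ} (hkpos : ∀ s, 0 < k s) (hZpos : ∀ s, 0 < Z s) (hZc : Continuous Z)
    (hk : ∀ s, HasDerivAt k (Z s - phaseFun ρ lam τ (k s)) s)
    (hV : ∀ s, HasDerivAt V (k s * V s) s)
    (hVZ : ∀ s, V s = Z s ^ (1 / (q - 1)) * Real.exp (-((θ + 2) / (q - 1)) * s)) :
    IsSolutionE N ρ lam τ θ q univ fun x => V (Real.log ‖x‖) := by
  have hq0 : q - 1 ≠ 0 := (sub_pos.2 hq).ne'
  have hVpos : ∀ s, 0 < V s := fun s => by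
    rw [hVZ]
    exact mul_pos (Real.rpow_pos_of_pos (hZpos s) _) (Real.exp_pos _)
  have hVpow : ∀ s, V s ^ q = V s * (Z s * Real.exp (-(θ + 2) * s)) := fun s => by
    have h1 : V s ^ (q - 1) = Z s * Real.exp (-(θ + 2) * s) := by
      rw [hVZ, Real.mul_rpow (Real.rpow_nonneg (hZpos s).le _) (Real.exp_pos _).le,
        ← Real.rpow_mul (hZpos s).le, one_div_mul_cancel hq0, Real.rpow_one, ← Real.exp_mul]
      congr 2
      field_simp
    rw [← h1, ← Real.rpow_one_add' (hVpos s).le (by linarith)]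
    congr 1
    ring
  have hkc : Continuous k := continuous_iff_continuousAt.2 fun s => (hk s).continuousAt
  have hVc : Continuous V := continuous_iff_continuousAt.2 fun s => (hV s).continuousAt
  have hFc : Continuous fun s => phaseFun ρ lam τ (k s) := continuous_iff_continuousAt.2 fun s =>
    (hasDerivAt_phaseFun (hkpos s)).continuousAt.comp hkc.continuousAt
  have hlog : ContinuousOn Real.log (Ioi 0) :=
    Real.continuousOn_log.mono fun r hr => (mem_Ioi.1 hr).ne'
  refine isSolutionE_of_radial (v := fun r => V (Real.log r)) hτ1
    (p := fun r => k (Real.log r) * V (Real.log r) / r ^ 2)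
    (p' := fun r => (Z (Real.log r) - phaseFun ρ lam τ (k (Real.log r)) + k (Real.log r) ^ 2
      - 2 * k (Real.log r)) * V (Real.log r) / r ^ 3) ?_ ?_ ?_ (fun r _ => hVpos _) ?_
  · intro r hr
    refine ((hV (Real.log r)).comp r (Real.hasDerivAt_log hr.ne')).congr_deriv ?_
    have := hr.ne'
    field_simp
  · intro r hr
    have hlr := Real.hasDerivAt_log hr.ne'
    have h2 : HasDerivAt (fun r : ℝ => r ^ 2) (2 * r) r := by
      simpa using (hasDerivAt_id r).fun_pow 2
    refine ((((hk (Real.log r)).comp r hlr).mul ((hV (Real.log r)).comp r hlr)).div h2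
      (pow_pos hr 2).ne').congr_deriv ?_
    have := hr.ne'
    simp only [Function.comp_apply, Pi.mul_apply]
    field_simp
  · have hc : ∀ {g : ℝ → ℝ}, Continuous g → ContinuousOn (fun r => g (Real.log r)) (Ioi 0) :=
      fun hg => hg.comp_continuousOn hlog
    refine ContinuousOn.div ?_ (by fun_prop) fun r hr => (pow_pos (mem_Ioi.1 hr) 3).ne'
    exact ((((hc hZc).sub (hc hFc)).add ((hc hkc).pow 2)).sub
      (continuousOn_const.mul (hc hkc))).mul (hc hVc)
  · intro r hr
    set s := Real.log r with hs
    have hks := hkpos s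
    have hVs := hVpos s
    have h1 : r * (k s * V s / r ^ 2) = k s * V s / r := by field_simp
    have h2 : V s ^ τ * (k s * V s / r) ^ (1 - τ) / r ^ (τ + 1) =
        V s * k s ^ (1 - τ) / r ^ 2 := by
      have e1 : V s ^ τ * V s ^ (1 - τ) = V s := by
        rw [← Real.rpow_add hVs, add_sub_cancel, Real.rpow_one]
      have e2 : r ^ (1 - τ) * r ^ (τ + 1) = r ^ 2 := by
        rw [← Real.rpow_add hr, show 1 - τ + (τ + 1) = (2 : ℕ) by push_cast; ring,
          Real.rpow_natCast]
      rw [Real.div_rpow (by positivity) hr.le, Real.mul_rpow hks.le hVs.le, mul_div_assoc',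
        div_div, e2]
      congr 1
      linear_combination k s ^ (1 - τ) * e1
    have h3 : Real.exp (-(θ + 2) * s) = r ^ (-θ) / r ^ 2 := by
      rw [mul_comm, hs, ← Real.rpow_def_of_pos hr, neg_add, Real.rpow_add hr,
        Real.rpow_neg hr.le 2, Real.rpow_two, div_eq_mul_inv]
    have h4 : r ^ θ * r ^ (-θ) = 1 := by
      rw [← Real.rpow_add hr, add_neg_cancel, Real.rpow_zero]
    rw [h1, abs_of_pos (by positivity), h2, hVpow, h3]
    have h5 : r ^ θ * (V s * (Z s * (r ^ (-θ) / r ^ 2))) = V s * Z s / r ^ 2 := by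
      linear_combination V s * Z s / r ^ 2 * h4
    rw [h5, phaseFun]
    field_simp
    ring

lemma tendsto_div_of_tendsto_div {α : Type*} {F : Filter α} {u v φ : α → ℝ}
    (hφ : ∀ᶠ x in F, φ x ≠ 0) (hu : Tendsto (fun x => u x / φ x) F (𝓝 1))
    (hv : Tendsto (fun x => v x / φ x) F (𝓝 1)) : Tendsto (fun x => u x / v x) F (𝓝 1) := by
  have h := hu.div hv one_ne_zero
  rw [div_one] at h
  refine h.congr' ?_
  filter_upwards [hφ] with x hx
  exact div_div_div_cancel_right₀ hx _ _

end Assembly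

/-- In Case [N₂] with `β ∈ (ϖ₂, 0)`, for every `b > 0` there is a unique
positive solution `u_b` of (E) in `ℝ^N \ {0}` with `u_b ~ b Φ_{ϖ₂}` near zero and
`u_b ~ U_{ρ,β}` at infinity; moreover `u_b` is radially symmetric with positive radial
derivative on `(0,∞)`. -/
theorem stmt3_exists_unique_u_b
    (N : ℕ) (hN : 2 ≤ N) (ρ lam τ θ q : ℝ)
    (hτ0 : 0 ≤ τ) (hτ1 : τ < 1) (hq : 1 < q)
    (hcase : CaseN2 ρ lam τ)
    (w2 : ℝ) (hw2 : IsMaxNegRoot ρ lam τ w2)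
    (hβ1 : w2 < (θ + 2) / (q - 1)) (hβ2 : (θ + 2) / (q - 1) < 0)
    (b : ℝ) (hb : 0 < b) :
    ∃ u : EuclideanSpace ℝ (Fin N) → ℝ,
      IsSolutionE N ρ lam τ θ q Set.univ u ∧
      Filter.Tendsto (fun x : EuclideanSpace ℝ (Fin N) => u x / (b * Phi2 ρ lam τ w2 ‖x‖))
        (𝓝[≠] (0 : EuclideanSpace ℝ (Fin N))) (𝓝 1) ∧
      Filter.Tendsto (fun x : EuclideanSpace ℝ (Fin N) =>
          u x / ((fRho ρ lam τ ((θ + 2) / (q - 1))) ^ (1 / (q - 1)) *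
            ‖x‖ ^ (-((θ + 2) / (q - 1)))))
        (cocompact (EuclideanSpace ℝ (Fin N))) (𝓝 1) ∧
      (∃ v : ℝ → ℝ, ContDiffOn ℝ 1 v (Set.Ioi 0) ∧
        (∀ x : EuclideanSpace ℝ (Fin N), x ≠ 0 → u x = v ‖x‖) ∧
        ∀ r : ℝ, 0 < r → 0 < deriv v r) ∧
      ∀ u' : EuclideanSpace ℝ (Fin N) → ℝ,
        IsSolutionE N ρ lam τ θ q Set.univ u' →
        Filter.Tendsto (fun x : EuclideanSpace ℝ (Fin N) => u' x / (b * Phi2 ρ lam τ w2 ‖x‖))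
          (𝓝[≠] (0 : EuclideanSpace ℝ (Fin N))) (𝓝 1) →
        Filter.Tendsto (fun x : EuclideanSpace ℝ (Fin N) =>
            u' x / ((fRho ρ lam τ ((θ + 2) / (q - 1))) ^ (1 / (q - 1)) *
              ‖x‖ ^ (-((θ + 2) / (q - 1)))))
          (cocompact (EuclideanSpace ℝ (Fin N))) (𝓝 1) →
        ∀ x : EuclideanSpace ℝ (Fin N), x ≠ 0 → u' x = u x := by

  obtain ⟨hlam, hτ, -, -⟩ := hcase
  have : NeZero N := ⟨by omega⟩
  set β := (θ + 2) / (q - 1) with hβ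
  have hm : 0 < q - 1 := sub_pos.2 hq
  obtain ⟨k, Z, V, hkpos, hZpos, hZc, hk, hV, hVZ, hZtop, hVbot⟩ :=
    exists_log_profile hlam hτ hτ1 hw2 hm (neg_pos.2 hβ2) (neg_lt_neg hβ1) (Real.log b)
  have hVpos : ∀ s, 0 < V s := fun s => by
    rw [hVZ]
    exact mul_pos (Real.rpow_pos_of_pos (hZpos s) _) (Real.exp_pos _)
  have hfβ : fRho ρ lam τ β = phaseFun ρ lam τ (-β) := by
    rw [← fRho_neg_eq_phaseFun (neg_pos.2 hβ2), neg_neg]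
  have hΛ : 0 < fRho ρ lam τ β :=
    hfβ ▸ phaseFun_pos hlam hτ hτ1 hw2 (neg_pos.2 hβ2) (neg_lt_neg hβ1)
  have hsol : IsSolutionE N ρ lam τ θ q Set.univ fun x => V (Real.log ‖x‖) :=
    isSolutionE_of_log_profile hτ1 hq hkpos hZpos hZc hk hV hVZ
  have hlog0 : Tendsto (fun x : EuclideanSpace ℝ (Fin N) => Real.log ‖x‖) (𝓝[≠] 0) atBot :=
    Real.tendsto_log_nhdsGT_zero.comp tendsto_norm_nhdsNE_zero
  have hnear : ∀ᶠ x : EuclideanSpace ℝ (Fin N) in 𝓝[≠] 0, 0 < ‖x‖ ∧ ‖x‖ < 1 := by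
    filter_upwards [tendsto_norm_nhdsNE_zero.eventually (Ioo_mem_nhdsGT one_pos)] with x hx
    exact hx
  have hfar : ∀ᶠ x : EuclideanSpace ℝ (Fin N) in cocompact _, 0 < ‖x‖ :=
    tendsto_norm_cocompact_atTop.eventually_gt_atTop 0
  have hzero : Tendsto (fun x : EuclideanSpace ℝ (Fin N) =>
      V (Real.log ‖x‖) / (b * Phi2 ρ lam τ w2 ‖x‖)) (𝓝[≠] 0) (𝓝 1) := by
    have h1 := ((hVbot.sub_const (Real.log b)).rexp).comp hlog0
    rw [sub_self, Real.exp_zero] at h1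
    refine h1.congr' ?_
    filter_upwards [hnear] with x hx
    rw [Phi2_eq_exp hx.1 hx.2, Function.comp_apply]
    rw [← Real.exp_log hb, ← Real.exp_add, ← Real.exp_log (hVpos (Real.log ‖x‖)), ← Real.exp_sub]
    simp only [Real.log_exp]
    congr 1
    ring
  have hinf : Tendsto (fun x : EuclideanSpace ℝ (Fin N) =>
      V (Real.log ‖x‖) / (fRho ρ lam τ β ^ (1 / (q - 1)) * ‖x‖ ^ (-β))) (cocompact _) (𝓝 1) := by
    have h1 : Tendsto (fun s => Z s ^ (1 / (q - 1)) / fRho ρ lam τ β ^ (1 / (q - 1))) atTop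
        (𝓝 1) := by
      have h2 := (hZtop.rpow_const (p := 1 / (q - 1)) (Or.inl (hfβ ▸ hΛ.ne'))).div_const
        (fRho ρ lam τ β ^ (1 / (q - 1)))
      rwa [← hfβ, div_self (Real.rpow_pos_of_pos hΛ _).ne'] at h2
    refine (h1.comp (Real.tendsto_log_atTop.comp tendsto_norm_cocompact_atTop)).congr' ?_
    filter_upwards [hfar] with x hx
    rw [hVZ, Real.rpow_def_of_pos hx, mul_comm (Real.log ‖x‖),
      mul_div_mul_right _ _ (Real.exp_pos _).ne']
    rfl
  refine ⟨fun x => V (Real.log ‖x‖), hsol, hzero, hinf,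
    ⟨fun r => V (Real.log r), ?_, fun x _ => rfl, fun r hr => ?_⟩, ?_⟩
  · refine contDiffOn_one_of_hasDerivAt isOpen_Ioi (fun r hr =>
      (hV (Real.log r)).comp r (Real.hasDerivAt_log (Set.mem_Ioi.1 hr).ne')) ?_
    have hkc : Continuous k := continuous_iff_continuousAt.2 fun s => (hk s).continuousAt
    have hVc : Continuous V := continuous_iff_continuousAt.2 fun s => (hV s).continuousAt
    refine ((hkc.mul hVc).comp_continuousOn (Real.continuousOn_log.mono fun r hr => ?_)).mul
      (continuousOn_id.inv₀ fun r hr => (Set.mem_Ioi.1 hr).ne')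
    exact (Set.mem_Ioi.1 hr).ne'
  · have h1 := (hV (Real.log r)).comp r (Real.hasDerivAt_log hr.ne')
    have h2 : deriv (fun r => V (Real.log r)) r = _ := h1.deriv
    rw [h2]
    exact mul_pos (mul_pos (hkpos _) (hVpos _)) (inv_pos.2 hr)
  · intro u' hu' hu'0 hu'inf x hx
    have hΦ : ∀ᶠ x : EuclideanSpace ℝ (Fin N) in 𝓝[≠] 0, b * Phi2 ρ lam τ w2 ‖x‖ ≠ 0 := by
      filter_upwards [hnear] with x hx
      rw [Phi2_eq_exp hx.1 hx.2]
      exact (mul_pos hb (Real.exp_pos _)).ne'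
    have hU : ∀ᶠ x : EuclideanSpace ℝ (Fin N) in cocompact _,
        fRho ρ lam τ β ^ (1 / (q - 1)) * ‖x‖ ^ (-β) ≠ 0 := by
      filter_upwards [hfar] with x hx
      exact (mul_pos (Real.rpow_pos_of_pos hΛ _) (Real.rpow_pos_of_pos hx _)).ne'
    exact le_antisymm
      (solution_le_of_tendsto hτ1 hq hu' hsol (tendsto_div_of_tendsto_div hΦ hu'0 hzero)
        (tendsto_div_of_tendsto_div hU hu'inf hinf) hx)
      (solution_le_of_tendsto hτ1 hq hsol hu' (tendsto_div_of_tendsto_div hΦ hzero hu'0)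
        (tendsto_div_of_tendsto_div hU hinf hu'inf) hx)

end
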